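/- arXiv:0812.3998 — 4 statements merged into one kernel-verified Lean document; each statement's English description precedes it below -/
import Mathlib

section
/- For all positive integers m and n there exists a positive constant Γ_{m,n} with the following property: for every collection of real numbers θ_{i,j} (1 ≤ i ≤ m, 1 ≤ j ≤ n), with associated linear forms L_j(x) = Σ_{i=1}^m θ_{i,j} x_i, there exist real numbers η_1, …, η_n such that inf over x ∈ ℤ^m \ {0} of (max_{1≤j≤n} ‖L_j(x) − η_j‖)^n · (max_{1≤i≤m} |x_i|)^m is strictly greater than Γ_{m,n}. -/
/-- Distance from a real number to the nearest integer. -/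
noncomputable def dnint (t : ℝ) : ℝ := ⨅ k : ℤ, |t - (k : ℝ)|

theorem dnint_eq (t : ℝ) : dnint t = |t - round t| := by
  unfold dnint
  apply le_antisymm
  · exact ciInf_le ⟨0, by rintro _ ⟨k, rfl⟩; exact abs_nonneg _⟩ (round t)
  · exact le_ciInf fun k => round_le t k

theorem step_lemma {n : ℕ} (a : Fin n → ℝ) (s : ℕ) (z : Fin n → ℤ)
    (hz : ∑ j, |(z j : ℝ)| ≤ 4 * 4 ^ s) :
    ∃ b : Fin n → ℝ, dist a b ≤ (1/16) * (1/4) ^ s ∧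
      ∀ k : ℤ, (∑ j, |(z j : ℝ)|) * ((1/16) * (1/4) ^ s) ≤ |∑ j, b j * z j - k| := by
  set w : ℝ := (1/16) * (1/4) ^ s with hw
  have hw0 : 0 < w := by positivity
  set d : ℝ := (∑ j, |(z j : ℝ)|) * w with hd
  have hd4 : d ≤ 1/4 := by
    have h1 : d ≤ (4 * 4 ^ s) * w := mul_le_mul_of_nonneg_right hz hw0.le
    have h2 : (4 * 4 ^ s) * w = 1/4 := by
      rw [hw, one_div_pow]; field_simp; norm_num
    linarith
  have key : ∀ e : ℝ, ∑ j, (a j + e * w * SignType.sign (z j : ℝ)) * z j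
      = ∑ j, a j * z j + e * d := by
    intro e
    rw [hd, Finset.sum_mul, Finset.mul_sum, ← Finset.sum_add_distrib]
    refine Finset.sum_congr rfl fun j _ => ?_
    rw [← sign_mul_self (z j : ℝ)]; ring
  have dd : ∀ e : ℝ, |e| = 1 →
      dist a (fun j => a j + e * w * SignType.sign (z j : ℝ)) ≤ w := by
    intro e he
    rw [dist_pi_le_iff hw0.le]
    intro j
    rw [Real.dist_eq]
    have : |a j - (a j + e * w * SignType.sign (z j : ℝ))| =
        w * |((SignType.sign (z j : ℝ) : SignType) : ℝ)| := by
      rw [sub_add_cancel_left, abs_neg, abs_mul, abs_mul, he, abs_of_pos hw0, one_mul]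
    rw [this]
    have : |((SignType.sign (z j : ℝ) : SignType) : ℝ)| ≤ 1 := by
      rcases SignType.trichotomy (SignType.sign (z j : ℝ)) with h | h | h <;> rw [h] <;> simp
    nlinarith
  by_contra! hcon
  obtain ⟨k, hk⟩ := hcon _ (dd 1 (by simp))
  obtain ⟨l, hl⟩ := hcon _ (dd (-1) (by simp))
  rw [key, abs_lt] at hk hl
  have h1 : l < k := by
    have : (l : ℝ) < k := by linarith
    exact_mod_cast this
  have h2 : k < l + 1 := by
    have : (k : ℝ) < l + 1 := by linarith
    exact_mod_cast this
  omega

theorem eta_lemma {n : ℕ} (z : ℕ → Fin n → ℤ)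
    (hz : ∀ s, ∑ j, |(z s j : ℝ)| ≤ 4 * 4 ^ s) (hz' : ∀ s, 4 ^ s ≤ ∑ j, |(z s j : ℝ)|) :
    ∃ η : Fin n → ℝ, ∀ s, ∀ k : ℤ, 1/24 ≤ |∑ j, η j * z s j - k| := by
  choose F hF1 hF2 using fun (a : Fin n → ℝ) s => step_lemma a s (z s) (hz s)
  let a : ℕ → Fin n → ℝ := fun s => Nat.rec 0 (fun s a => F a s) s
  have ha : ∀ s, a (s+1) = F (a s) s := fun s => rfl
  have h1 : ∀ s, dist (a s) (a (s+1)) ≤ (1/16) * (1/4) ^ s := fun s => by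
    rw [ha]; exact hF1 _ _
  obtain ⟨η, hη⟩ := cauchySeq_tendsto_of_complete
    (cauchySeq_of_le_geometric (1/4 : ℝ) (1/16) (by norm_num) h1)
  refine ⟨η, fun s k => ?_⟩
  have h2 := dist_le_of_le_geometric_of_tendsto (1/4 : ℝ) (1/16) (by norm_num) h1 hη (s+1)
  have h3 := hF2 (a s) s k
  rw [← ha] at h3
  set N := ∑ j, |(z s j : ℝ)| with hN
  have h4 : |∑ j, a (s+1) j * z s j - ∑ j, η j * z s j| ≤ N * ((1/48) * (1/4)^s) := by
    rw [← Finset.sum_sub_distrib, hN, Finset.sum_mul]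
    refine (Finset.abs_sum_le_sum_abs _ _).trans (Finset.sum_le_sum fun j _ => ?_)
    rw [← sub_mul, abs_mul, mul_comm]
    refine mul_le_mul_of_nonneg_left ?_ (abs_nonneg _)
    have := (dist_le_pi_dist (a (s+1)) η j).trans h2
    rw [Real.dist_eq] at this
    refine this.trans (le_of_eq ?_)
    rw [pow_succ]; ring
  have h5 : 1 ≤ N * (1/4)^s := by
    have : (4:ℝ)^s * (1/4)^s = 1 := by rw [← mul_pow]; norm_num
    exact this.symm.le.trans (mul_le_mul_of_nonneg_right (hz' s) (by positivity))
  have h6 : |∑ j, a (s+1) j * z s j - k| ≤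
      |∑ j, a (s+1) j * z s j - ∑ j, η j * z s j| + |∑ j, η j * z s j - k| := abs_sub_le _ _ _
  nlinarith

/-- size of the dual forms modulo one -/
noncomputable def zeta {m n : ℕ} (θ : Fin m → Fin n → ℝ) (y : Fin n → ℤ) : ℝ :=
  ‖fun i : Fin m => (∑ j, θ i j * (y j : ℝ)) - round (∑ j, θ i j * (y j : ℝ))‖

theorem dirichlet_lemma {m n : ℕ} (θ : Fin m → Fin n → ℝ) (B K : ℕ) (hK : 0 < K)
    (h : K ^ m < (B + 1) ^ n) :
    ∃ y : Fin n → ℤ, y ≠ 0 ∧ (∀ j, |(y j : ℝ)| ≤ B) ∧ zeta θ y ≤ 1 / K := by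
  have hKR : (0:ℝ) < K := by exact_mod_cast hK
  let M : (Fin n → Fin (B+1)) → Fin m → ℝ := fun y i => ∑ j, θ i j * ((y j : ℕ) : ℝ)
  have hlt : ∀ y i, ⌊Int.fract (M y i) * K⌋₊ < K := by
    intro y i
    rw [Nat.floor_lt (mul_nonneg (Int.fract_nonneg _) hKR.le)]
    nlinarith [Int.fract_lt_one (M y i)]
  let f : (Fin n → Fin (B+1)) → (Fin m → Fin K) := fun y i => ⟨_, hlt y i⟩
  obtain ⟨u, v, huv, hf⟩ := Fintype.exists_ne_map_eq_of_card_lt f (by simpa using h)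
  refine ⟨fun j => (u j : ℤ) - (v j : ℤ), ?_, ?_, ?_⟩
  · intro h0
    apply huv
    funext j
    have := congrFun h0 j
    simp only [Pi.zero_apply] at this
    apply Fin.ext
    omega
  · intro j
    have h1 : |((u j : ℤ) - (v j : ℤ))| ≤ B := by
      have := (u j).2
      have := (v j).2
      rw [abs_le]; omega
    exact_mod_cast h1
  · unfold zeta
    rw [pi_norm_le_iff_of_nonneg (by positivity)]
    intro i
    rw [Real.norm_eq_abs]
    have e : ∑ j, θ i j * (((u j : ℤ) - (v j : ℤ) : ℤ) : ℝ) = M u i - M v i := by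
      simp only [M]
      rw [← Finset.sum_sub_distrib]
      refine Finset.sum_congr rfl fun j _ => ?_
      push_cast; ring
    rw [e]
    refine (round_le _ (⌊M u i⌋ - ⌊M v i⌋)).trans ?_
    have e2 : M u i - M v i - ((⌊M u i⌋ - ⌊M v i⌋ : ℤ) : ℝ)
        = Int.fract (M u i) - Int.fract (M v i) := by
      simp only [Int.fract]; push_cast; ring
    rw [e2, le_div_iff₀ hKR, ← abs_of_pos hKR, ← abs_mul, sub_mul]
    have hfl : ⌊Int.fract (M u i) * K⌋₊ = ⌊Int.fract (M v i) * K⌋₊ := by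
      have := congrFun hf i
      simpa [f] using this
    have p1 := Nat.floor_le (mul_nonneg (Int.fract_nonneg (M u i)) hKR.le)
    have p2 := Nat.floor_le (mul_nonneg (Int.fract_nonneg (M v i)) hKR.le)
    have q1 := Nat.lt_floor_add_one (Int.fract (M u i) * K)
    have q2 := Nat.lt_floor_add_one (Int.fract (M v i) * K)
    rw [hfl] at p1 q1
    rw [abs_le]; constructor <;> linarith

theorem shell_lemma {m n : ℕ} (hn : 0 < n) (θ : Fin m → Fin n → ℝ) (s : ℕ) :
    ∃ z : Fin n → ℤ, (4 ^ s ≤ ∑ j, |z j| ∧ ∑ j, |z j| < 4 ^ (s+1)) ∧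
      ∀ y : Fin n → ℤ, (4 ^ s ≤ ∑ j, |y j| ∧ ∑ j, |y j| < 4 ^ (s+1)) → zeta θ z ≤ zeta θ y := by
  let S : Set (Fin n → ℤ) := {y | 4 ^ s ≤ ∑ j, |y j| ∧ ∑ j, |y j| < 4 ^ (s+1)}
  have hfin : S.Finite := by
    apply (Set.finite_Icc (fun _ : Fin n => -(4 ^ (s+1) : ℤ)) (fun _ => 4 ^ (s+1))).subset
    rintro y ⟨_, hy⟩
    have : ∀ j, |y j| ≤ 4 ^ (s+1) := fun j =>
      (Finset.single_le_sum (f := fun j => |y j|) (fun j _ => abs_nonneg _)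
        (Finset.mem_univ j)).trans hy.le
    exact ⟨fun j => (abs_le.1 (this j)).1, fun j => (abs_le.1 (this j)).2⟩
  have hne : S.Nonempty := by
    refine ⟨Pi.single ⟨0, hn⟩ (4 ^ s), ?_⟩
    have : ∑ j, |(Pi.single (⟨0, hn⟩ : Fin n) (4 ^ s : ℤ) : Fin n → ℤ) j| = 4 ^ s := by
      rw [Finset.sum_eq_single ⟨0, hn⟩]
      · simp
      · intro j _ hj; simp [Pi.single_eq_of_ne hj]
      · simp
    show _ ∧ _
    rw [this]
    have : (0:ℤ) < 4 ^ s := by positivity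
    exact ⟨le_rfl, by rw [pow_succ]; linarith⟩
  obtain ⟨z, hz, hmin⟩ := Set.exists_min_image S (zeta θ) hfin hne
  exact ⟨z, hz, hmin⟩

/-- Transference inequality. -/
theorem transfer_lemma {m n : ℕ} (θ : Fin m → Fin n → ℝ) (η : Fin n → ℝ) (z : Fin n → ℤ)
    (x : Fin m → ℤ) (X D : ℝ) (hX : ∀ i, |(x i : ℝ)| ≤ X)
    (hD : ∀ j, dnint ((∑ i, θ i j * (x i : ℝ)) - η j) ≤ D)
    (hη : ∀ k : ℤ, 1/24 ≤ |∑ j, η j * z j - k|) :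
    1/24 ≤ (∑ j, |(z j : ℝ)|) * D + m * X * zeta θ z := by
  let L : Fin n → ℝ := fun j => (∑ i, θ i j * (x i : ℝ)) - η j
  let M : Fin m → ℝ := fun i => ∑ j, θ i j * (z j : ℝ)
  have hswap : ∑ j, (z j : ℝ) * L j = ∑ i, (x i : ℝ) * M i - ∑ j, η j * z j := by
    simp only [L, M, mul_sub, Finset.mul_sum, Finset.sum_sub_distrib]
    rw [Finset.sum_comm]
    congr 1
    · refine Finset.sum_congr rfl fun i _ => Finset.sum_congr rfl fun j _ => by ring
    · refine Finset.sum_congr rfl fun j _ => by ring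
  have h1 := hη (∑ i, x i * round (M i) - ∑ j, z j * round (L j))
  have h2 : ∑ j, η j * z j - ((∑ i, x i * round (M i) - ∑ j, z j * round (L j) : ℤ) : ℝ)
      = ∑ i, (x i : ℝ) * (M i - round (M i)) - ∑ j, (z j : ℝ) * (L j - round (L j)) := by
    simp only [mul_sub, Finset.sum_sub_distrib]
    rw [hswap]; push_cast; ring
  rw [h2] at h1
  have h3 : |∑ i, (x i : ℝ) * (M i - round (M i))| ≤ m * X * zeta θ z := by
    refine (Finset.abs_sum_le_sum_abs _ _).trans ?_
    have : ∀ i ∈ Finset.univ, |(x i : ℝ) * (M i - round (M i))| ≤ X * zeta θ z := by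
      intro i _
      rw [abs_mul]
      refine mul_le_mul (hX i) ?_ (abs_nonneg _) ((abs_nonneg _).trans (hX i))
      exact norm_le_pi_norm (fun i => M i - round (M i)) i
    refine (Finset.sum_le_sum this).trans (le_of_eq ?_)
    simp; ring
  have h4 : |∑ j, (z j : ℝ) * (L j - round (L j))| ≤ (∑ j, |(z j : ℝ)|) * D := by
    refine (Finset.abs_sum_le_sum_abs _ _).trans ?_
    rw [Finset.sum_mul]
    refine Finset.sum_le_sum fun j _ => ?_
    rw [abs_mul]
    refine mul_le_mul_of_nonneg_left ?_ (abs_nonneg _)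
    rw [← dnint_eq]; exact hD j
  have := abs_sub (∑ i, (x i : ℝ) * (M i - round (M i))) (∑ j, (z j : ℝ) * (L j - round (L j)))
  linarith

/-- Cassels' theorem on badly approximable inhomogeneous linear forms. -/
theorem cassels_badly_approximable (m n : ℕ) (hm : 0 < m) (hn : 0 < n) :
    ∃ Γ : ℝ, 0 < Γ ∧
      ∀ θ : Fin m → Fin n → ℝ,
        ∃ η : Fin n → ℝ,
          Γ < ⨅ x : {x : Fin m → ℤ // x ≠ 0},
              (⨆ j : Fin n, dnint ((∑ i : Fin m, θ i j * (x.val i : ℝ)) - η j)) ^ n *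
                (⨆ i : Fin m, (|x.val i| : ℝ)) ^ m := by
  have hmR : (0:ℝ) < m := by exact_mod_cast hm
  have hnR : (0:ℝ) < n := by exact_mod_cast hn
  set G : ℝ := (1 / (192 * n)) ^ n * (1 / (48 * m)) ^ m with hG
  have hG0 : 0 < G := by positivity
  refine ⟨G / 2, by positivity, fun θ => ?_⟩
  choose z hz hmin using shell_lemma hn θ
  have cast1 : ∀ y : Fin n → ℤ, ∑ j, |(y j : ℝ)| = ((∑ j, |y j| : ℤ) : ℝ) := by
    intro y; push_cast; rfl
  obtain ⟨η, hη⟩ := eta_lemma z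
    (fun s => by
      have := (hz s).2.le
      rw [cast1]
      rw [pow_succ, mul_comm] at this
      exact_mod_cast this)
    (fun s => by rw [cast1]; exact_mod_cast (hz s).1)
  refine ⟨η, lt_of_lt_of_le (half_lt_self hG0) ?_⟩
  have : Nonempty {x : Fin m → ℤ // x ≠ 0} :=
    ⟨⟨fun _ => 1, fun h => by simpa using congrFun h ⟨0, hm⟩⟩⟩
  refine le_ciInf ?_
  rintro ⟨x, hx⟩
  simp only
  have : Nonempty (Fin m) := ⟨⟨0, hm⟩⟩
  obtain ⟨i0, hi0⟩ := Finite.exists_max (fun i => (x i).natAbs)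
  set X : ℕ := (x i0).natAbs with hXdef
  have hXpos : 0 < X := by
    rcases Nat.eq_zero_or_pos X with h | h
    · exfalso; apply hx; funext i
      have := hi0 i
      simp only [Pi.zero_apply]; omega
    · exact h
  have hXR : (0:ℝ) < X := by exact_mod_cast hXpos
  have hnat : ∀ i, |(x i : ℝ)| = ((x i).natAbs : ℝ) := fun i => by
    rw [Nat.cast_natAbs]; push_cast; rfl
  have hXle : ∀ i, |(x i : ℝ)| ≤ X := fun i => by
    rw [hnat]; exact_mod_cast hi0 i
  have hXsup : (X : ℝ) ≤ ⨆ i, |(x i : ℝ)| := by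
    rw [hXdef, ← hnat]
    exact le_ciSup (f := fun i => |(x i : ℝ)|) (Set.finite_range _).bddAbove i0
  set D : ℝ := ⨆ j : Fin n, dnint ((∑ i : Fin m, θ i j * (x i : ℝ)) - η j) with hDdef
  have hD : ∀ j, dnint ((∑ i, θ i j * (x i : ℝ)) - η j) ≤ D := fun j =>
    le_ciSup (f := fun j => dnint ((∑ i, θ i j * (x i : ℝ)) - η j)) (Set.finite_range _).bddAbove j
  -- choose parameters
  set K : ℕ := 48 * m * X with hKdef
  have hK : 0 < K := by positivity
  have hex : ∃ B : ℕ, K ^ m < (B + 1) ^ n :=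
    ⟨K ^ m, lt_of_lt_of_le (Nat.lt_succ_self _) (Nat.le_self_pow hn.ne' _)⟩
  classical
  set B := Nat.find hex with hB
  have hB1 : K ^ m < (B + 1) ^ n := Nat.find_spec hex
  have hB0 : B ≠ 0 := by
    intro h
    rw [h] at hB1
    have := Nat.one_le_pow m K hK
    simp at hB1
    omega
  have hB2 : B ^ n ≤ K ^ m := by
    have := Nat.find_min hex (m := B - 1) (by omega)
    rw [Nat.sub_add_cancel (by omega)] at this
    omega
  have hBR : (0:ℝ) < B := by exact_mod_cast Nat.pos_of_ne_zero hB0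
  obtain ⟨y, hy0, hyB, hyz⟩ := dirichlet_lemma θ B K hK hB1
  have hN : 0 < ∑ j, |y j| := by
    rcases (Finset.sum_nonneg fun j (_ : j ∈ Finset.univ) => abs_nonneg (y j)).lt_or_eq with h | h
    · exact h
    · exfalso; apply hy0; funext j
      have := (Finset.sum_eq_zero_iff_of_nonneg fun j (_ : j ∈ Finset.univ) =>
        abs_nonneg (y j)).1 h.symm j (Finset.mem_univ j)
      simpa using this
  obtain ⟨N, hNe⟩ := Int.eq_ofNat_of_zero_le hN.le
  have hNpos : N ≠ 0 := by rintro rfl; simp [hNe] at hN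
  set s := Nat.log 4 N with hs
  have hs1 : 4 ^ s ≤ N := Nat.pow_log_le_self 4 hNpos
  have hs2 : N < 4 ^ (s+1) := Nat.lt_pow_succ_log_self (by norm_num) N
  have hys : zeta θ (z s) ≤ zeta θ y := by
    apply hmin s y
    rw [hNe]
    exact ⟨by exact_mod_cast hs1, by exact_mod_cast hs2⟩
  have hNB : (N : ℝ) ≤ n * B := by
    have : (N : ℝ) = ∑ j, |(y j : ℝ)| := by rw [cast1, hNe]; simp
    rw [this]
    refine (Finset.sum_le_sum fun j _ => hyB j).trans (le_of_eq ?_)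
    simp
  have hzB : ∑ j, |(z s j : ℝ)| ≤ 4 * n * B := by
    have h1 : ∑ j, |(z s j : ℝ)| ≤ 4 ^ (s+1) := by
      rw [cast1]; exact_mod_cast (hz s).2.le
    have h2 : (4:ℝ) ^ s ≤ N := by exact_mod_cast hs1
    rw [pow_succ] at h1
    nlinarith
  have hD0 : 0 ≤ D := by
    refine le_trans ?_ (hD ⟨0, hn⟩)
    rw [dnint_eq]; exact abs_nonneg _
  have ht := transfer_lemma θ η (z s) x X D hXle hD (hη s)
  have h48 : m * X * zeta θ (z s) ≤ 1/48 := by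
    have h1 : m * X * zeta θ (z s) ≤ m * X * (1 / K) :=
      mul_le_mul_of_nonneg_left (hys.trans hyz) (by positivity)
    refine h1.trans (le_of_eq ?_)
    rw [hKdef]; push_cast; field_simp
  have hDlow : 1 / (192 * n) / B ≤ D := by
    have h1 : (∑ j, |(z s j : ℝ)|) * D ≤ 4 * n * B * D := mul_le_mul_of_nonneg_right hzB hD0
    rw [div_div, div_le_iff₀ (by positivity)]
    linarith
  have hB2R : (B:ℝ) ^ n ≤ (48 * m * X) ^ m := by
    have : ((B ^ n : ℕ) : ℝ) ≤ ((K ^ m : ℕ) : ℝ) := by exact_mod_cast hB2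
    rw [hKdef] at this
    push_cast at this
    exact this
  calc G = (1 / (192 * n)) ^ n / (48 * m * X) ^ m * X ^ m := by
        rw [hG, mul_pow _ (X:ℝ), one_div_pow (48 * (m:ℝ))]; field_simp
    _ ≤ (1 / (192 * n)) ^ n / B ^ n * X ^ m := by gcongr
    _ = (1 / (192 * n) / B) ^ n * X ^ m := by rw [div_pow _ (B:ℝ)]
    _ ≤ D ^ n * (⨆ i, |(x i : ℝ)|) ^ m := by gcongr
end

section
/- Let m, n be positive integers and let 𝓑 be the set of real (m+1)×n matrices (θ_{i,j}, η_j) (1 ≤ i ≤ m, 1 ≤ j ≤ n), viewed as points of ℝ^{mn+n}, for which inf over x ∈ ℤ^m \ {0} of (max_{1≤j≤n} ‖L_j(x) − η_j‖)^n · (max_{1≤i≤m} |x_i|)^m > 0. Then 𝓑 has full Hausdorff dimension in ℝ^{mn+n}, i.e. its Hausdorff dimension equals mn + n. -/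
open MeasureTheory Filter Topology Metric Module
open scoped ENNReal NNReal

/-- Slicing: if all slices have infinite `d`-dimensional measure, the set has dimension at least
`finrank E + d`. -/
theorem slice_aux {E F : Type*} [NormedAddCommGroup E] [NormedSpace ℝ E] [FiniteDimensional ℝ E]
    [MeasurableSpace E] [BorelSpace E]
    [NormedAddCommGroup F] [NormedSpace ℝ F] [FiniteDimensional ℝ F]
    [MeasurableSpace F] [BorelSpace F]
    (B : Set (E × F)) (d : ℝ≥0) (hd : 0 < d)
    (h : ∀ θ : E, μH[(d : ℝ)] {η | (θ, η) ∈ B} ≠ 0) :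
    ((finrank ℝ E : ℝ≥0) + d : ℝ≥0) ≤ dimH B := by
  apply le_dimH_of_hausdorffMeasure_ne_zero
  intro h0
  rw [Measure.hausdorffMeasure_apply] at h0
  simp only [ENNReal.iSup_eq_zero] at h0
  have key : ∀ k : ℕ, ∃ t : ℕ → Set (E × F), B ⊆ ⋃ n, t n ∧
      (∀ n, ediam (t n) ≤ ((k : ℝ≥0∞) + 1)⁻¹) ∧
      ∑' n, ⨆ _ : (t n).Nonempty, ediam (t n) ^ (((finrank ℝ E : ℝ≥0) + d : ℝ≥0) : ℝ)
        < ((k : ℝ≥0∞) + 1)⁻¹ := by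
    intro k
    have hp : (0 : ℝ≥0∞) < ((k : ℝ≥0∞) + 1)⁻¹ := by simp
    have h1 := h0 _ hp
    have h2 : (⨅ (t : ℕ → Set (E × F)) (_ : B ⊆ ⋃ n, t n)
      (_ : ∀ n, ediam (t n) ≤ ((k : ℝ≥0∞) + 1)⁻¹),
          ∑' n, ⨆ _ : (t n).Nonempty, ediam (t n) ^ (((finrank ℝ E : ℝ≥0) + d : ℝ≥0) : ℝ))
            < ((k : ℝ≥0∞) + 1)⁻¹ := by rw [h1]; exact hp
    simp only [iInf_lt_iff] at h2
    obtain ⟨t, h3, h4, h5⟩ := h2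
    exact ⟨t, h3, h4, h5⟩
  choose t htB htd hts using key
  let μ : Measure E := Measure.addHaar
  have hμ : μ.IsAddHaarMeasure := by infer_instance
  have hfin : ∀ k n, ediam (t k n) ≠ ∞ := fun k n =>
    ne_top_of_le_ne_top (by simp) (htd k n)
  have hball : ∀ k n, ∃ S : Set E, MeasurableSet S ∧ (∀ p ∈ t k n, p.1 ∈ S) ∧
      ediam (t k n) ^ (d : ℝ) * μ S ≤ μ (ball 0 1) * ⨆ _ : (t k n).Nonempty,
        ediam (t k n) ^ (((finrank ℝ E : ℝ≥0) + d : ℝ≥0) : ℝ) := by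
    intro k n
    rcases (t k n).eq_empty_or_nonempty with he | hne
    · exact ⟨∅, MeasurableSet.empty, by simp [he], by simp⟩
    · obtain ⟨q, hq⟩ := hne
      refine ⟨closedBall q.1 (ediam (t k n)).toReal, isClosed_closedBall.measurableSet, ?_, ?_⟩
      · intro p hp
        rw [mem_closedBall, dist_edist]
        apply ENNReal.toReal_mono (hfin k n)
        exact le_trans (by rw [Prod.edist_eq]; exact le_max_left _ _) (edist_le_ediam_of_mem hp hq)
      · rw [Measure.addHaar_closedBall _ _ ENNReal.toReal_nonneg]
        have : (t k n).Nonempty := ⟨q, hq⟩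
        simp only [this, iSup_pos]
        rw [ENNReal.ofReal_pow ENNReal.toReal_nonneg, ENNReal.ofReal_toReal (hfin k n),
          NNReal.coe_add, ENNReal.rpow_add_of_nonneg _ _ (by positivity) (by positivity)]
        simp only [NNReal.coe_natCast, ENNReal.rpow_natCast]
        apply le_of_eq; ring
  choose S hSm hSp hSb using hball
  let f : ℕ → E → ℝ≥0∞ := fun k θ => ∑' n, (S k n).indicator (fun _ => ediam (t k n) ^ (d : ℝ)) θ
  have hfm : ∀ k, Measurable (f k) := fun k =>
    Measurable.tsum fun n => measurable_const.indicator (hSm k n)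
  have hfi : ∀ k, ∫⁻ θ, f k θ ∂μ ≤ μ (ball 0 1) * ((k : ℝ≥0∞) + 1)⁻¹ := by
    intro k
    simp only [f]
    rw [lintegral_tsum (fun n => (measurable_const.indicator (hSm k n)).aemeasurable)]
    calc _ = ∑' n, ediam (t k n) ^ (d : ℝ) * μ (S k n) := by
          congr 1; ext n; rw [lintegral_indicator_const (hSm k n)]
      _ ≤ ∑' n, μ (ball 0 1) * ⨆ _ : (t k n).Nonempty,
        ediam (t k n) ^ (((finrank ℝ E : ℝ≥0) + d : ℝ≥0) : ℝ) := ENNReal.tsum_le_tsum (hSb k)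
      _ = _ := ENNReal.tsum_mul_left
      _ ≤ _ := by gcongr; exact (hts k).le
  have hr0 : Tendsto (fun k : ℕ => ((k : ℝ≥0∞) + 1)⁻¹) atTop (𝓝 0) := by
    have := ENNReal.tendsto_inv_nat_nhds_zero.comp (tendsto_add_atTop_nat 1)
    refine this.congr fun k => ?_
    simp
  have hlim : ∫⁻ θ, liminf (fun k => f k θ) atTop ∂μ = 0 := by
    apply le_antisymm _ (zero_le)
    refine (lintegral_liminf_le hfm).trans ?_
    have h1 : Tendsto (fun k : ℕ => μ (ball 0 1) * ((k : ℝ≥0∞) + 1)⁻¹) atTop (𝓝 0) := by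
      have := ENNReal.Tendsto.const_mul (a := μ (ball 0 1)) hr0
        (Or.inr (measure_ball_lt_top.ne))
      simpa using this
    have h2 : Tendsto (fun k => ∫⁻ θ, f k θ ∂μ) atTop (𝓝 0) :=
      tendsto_of_tendsto_of_tendsto_of_le_of_le tendsto_const_nhds h1 (fun _ => zero_le) hfi
    exact h2.liminf_eq.le
  rw [lintegral_eq_zero_iff (Measurable.liminf hfm)] at hlim
  obtain ⟨θ, hθ⟩ := hlim.exists
  apply h θ
  apply le_antisymm _ (zero_le)
  refine le_trans (Measure.hausdorffMeasure_le_liminf_tsum (d : ℝ) _ (l := atTop) _ hr0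
    (fun k n => {η | (θ, η) ∈ t k n}) ?_ ?_) ?_
  · refine Eventually.of_forall fun k n => le_trans ?_ (htd k n)
    apply ediam_le
    intro x hx y hy
    refine le_trans ?_ (edist_le_ediam_of_mem hx hy)
    rw [Prod.edist_eq]; exact le_max_right _ _
  · refine Eventually.of_forall fun k η hη => ?_
    have := htB k hη
    simpa using this
  · refine le_trans (liminf_le_liminf (Eventually.of_forall fun k => ?_)) hθ.le
    refine ENNReal.tsum_le_tsum fun n => ?_
    rcases Set.eq_empty_or_nonempty {η | (θ, η) ∈ t k n} with he | ⟨η, hη⟩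
    · rw [he]; simp [hd]
    · rw [Set.indicator_of_mem (hSp k n _ hη)]
      gcongr
      apply ediam_le
      intro x hx y hy
      refine le_trans ?_ (edist_le_ediam_of_mem hx hy)
      rw [Prod.edist_eq]; exact le_max_right _ _

/-- A separated coding of a Cantor set yields a lower bound for its dimension. -/
theorem coding_dimH {X : Type*} [MetricSpace X] (Q : ℕ) (hQ : 1 < Q) (φ : (ℕ → Fin Q) → X)
    (R r0 : ℝ) (hR : 0 < R) (hr0 : 0 < r0) (s : ℝ≥0) (hs : 0 < s) (hRs : R ^ (s : ℝ) ≤ Q)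
    (hsep : ∀ ω ω' : ℕ → Fin Q, ∀ k, (∀ i < k, ω i = ω' i) → ω k ≠ ω' k →
      r0 * (R ^ k)⁻¹ ≤ dist (φ ω) (φ ω')) :
    (s : ℝ≥0∞) ≤ dimH (Set.range φ) := by
  have hfirst : ∀ ω ω' : ℕ → Fin Q, ω ≠ ω' → ∃ k, (∀ i < k, ω i = ω' i) ∧ ω k ≠ ω' k := by
    intro ω ω' hne
    have hex : ∃ k, ω k ≠ ω' k := Function.ne_iff.mp hne
    classical
    refine ⟨Nat.find hex, fun i hi => ?_, Nat.find_spec hex⟩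
    have := Nat.find_min hex hi
    simpa using this
  have hinj : Function.Injective φ := by
    intro ω ω' he
    by_contra hne
    obtain ⟨k, h1, h2⟩ := hfirst ω ω' hne
    have := hsep ω ω' k h1 h2
    rw [he, dist_self] at this
    have : 0 < r0 * (R ^ k)⁻¹ := by positivity
    linarith
  have : Nonempty (ℕ → Fin Q) := ⟨fun _ => ⟨0, by omega⟩⟩
  let g : X → ℝ := fun x => Real.ofDigits (Function.invFun φ x)
  have hg : ∀ ω, g (φ ω) = Real.ofDigits ω := fun ω => by
    simp only [g, Function.leftInverse_invFun hinj ω]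
  let C : ℝ≥0 := ⟨(r0⁻¹) ^ (s : ℝ), by positivity⟩
  have hH : HolderOnWith C s g (Set.range φ) := by
    rintro _ ⟨ω, rfl⟩ _ ⟨ω', rfl⟩
    by_cases hne : ω = ω'
    · subst hne; simp
    obtain ⟨k, h1, h2⟩ := hfirst ω ω' hne
    have hd := hsep ω ω' k h1 h2
    have hbound : dist (g (φ ω)) (g (φ ω')) ≤ (C : ℝ) * dist (φ ω) (φ ω') ^ (s : ℝ) := by
      rw [hg, hg, Real.dist_eq]
      refine (Real.abs_ofDigits_sub_ofDigits_le h1).trans ?_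
      have h3 : (R ^ k)⁻¹ ≤ r0⁻¹ * dist (φ ω) (φ ω') := by
        rw [le_inv_mul_iff₀ hr0]; exact hd
      have h4 : ((Q : ℝ) ^ k)⁻¹ ≤ ((R ^ k)⁻¹) ^ (s : ℝ) := by
        rw [Real.inv_rpow (by positivity), ← Real.rpow_natCast R k, ← Real.rpow_mul hR.le,
          mul_comm, Real.rpow_mul hR.le, Real.rpow_natCast]
        gcongr
      refine h4.trans ?_
      show _ ≤ (r0⁻¹) ^ (s : ℝ) * _
      rw [← Real.mul_rpow (by positivity) dist_nonneg]
      gcongr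
    rw [edist_dist, edist_dist, ENNReal.ofReal_rpow_of_nonneg dist_nonneg s.coe_nonneg,
      ← ENNReal.ofReal_coe_nnreal, ← ENNReal.ofReal_mul C.coe_nonneg]
    exact ENNReal.ofReal_le_ofReal hbound
  have h1 := hH.dimH_image_le hs
  have h2 : dimH (Set.Icc (0:ℝ) 1) ≤ dimH (Set.image g (Set.range φ)) := by
    apply dimH_mono
    intro y hy
    obtain ⟨ω, -, rfl⟩ := Real.ofDigits_SurjOn hQ hy
    exact ⟨φ ω, ⟨ω, rfl⟩, hg ω⟩
  have h3 : dimH (Set.Icc (0:ℝ) 1) = 1 := by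
    rw [Real.dimH_of_nonempty_interior (by rw [interior_Icc]; exact ⟨1/2, by norm_num⟩)]
    simp
  rw [h3] at h2
  have h4 := h2.trans h1
  rwa [ENNReal.le_div_iff_mul_le (Or.inl (by simpa using hs.ne')) (Or.inl (by simp)), one_mul] at h4

/-- At most `(n+1) H^(n-1)` of the `H^n` children boxes meet the set where `η·y` is close to an
integer. -/
theorem count_bad (n H : ℕ) (p : Fin n → ℝ) (ρ c A : ℝ) (y : Fin n → ℤ) (j : Fin n)
    (hj : |(y j : ℝ)| = A) (hA : ∀ i, |(y i : ℝ)| ≤ A) (hA0 : 0 < A) (hρ : 0 < ρ)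
    (hc : c ≤ ρ * A) (hc4 : c ≤ 1 / 4) (hsmall : n * (2 * H * ρ) * A ≤ 1 / 4)
    (bad : Finset (Fin n → Fin H))
    (hbad : ∀ v ∈ bad, ∃ η : Fin n → ℝ, (∀ i, p i + 2 * ρ * (v i : ℕ) ≤ η i ∧
      η i ≤ p i + 2 * ρ * (v i : ℕ) + ρ) ∧ ∃ z : ℤ, |∑ i, η i * y i - z| < c) :
    bad.card ≤ (n + 1) * H ^ (n - 1) := by
  classical
  let F : (Fin n → Fin H) → Fin (n + 1) × ({i : Fin n // i ≠ j} → Fin H) := fun v =>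
    (⟨(v j : ℕ) % (n + 1), Nat.mod_lt _ (Nat.succ_pos n)⟩, fun i => v i)
  have hcard : Fintype.card (Fin (n + 1) × ({i : Fin n // i ≠ j} → Fin H))
      = (n + 1) * H ^ (n - 1) := by
    simp
  rw [← hcard, ← Finset.card_univ]
  refine Finset.card_le_card_of_injOn F (fun _ _ => Finset.mem_coe.2 (Finset.mem_univ _)) ?_
  intro v hv v' hv' hF
  have hF1 : (v j : ℕ) % (n + 1) = (v' j : ℕ) % (n + 1) := by
    have := congrArg (fun q => (q.1 : ℕ)) hF
    simpa [F] using this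
  have hF2 : ∀ i, i ≠ j → v i = v' i := fun i hi => by
    have := congrFun (congrArg Prod.snd hF) ⟨i, hi⟩
    simpa [F] using this
  obtain ⟨η, hη, z, hz⟩ := hbad v hv
  obtain ⟨η', hη', z', hz'⟩ := hbad v' hv'
  have hvH : ∀ (w : Fin n → Fin H) i, ((w i : ℕ) : ℝ) + 1 ≤ H := fun w i => by
    exact_mod_cast (w i).2
  -- the two integers agree
  have hdiff : |∑ i, η i * y i - ∑ i, η' i * y i| ≤ 1 / 4 := by
    rw [← Finset.sum_sub_distrib]
    refine (Finset.abs_sum_le_sum_abs _ _).trans ?_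
    calc ∑ i, |η i * y i - η' i * y i| ≤ ∑ i : Fin n, (2 * H * ρ) * A := by
          refine Finset.sum_le_sum fun i _ => ?_
          rw [← sub_mul, abs_mul]
          have h1 := hη i; have h2 := hη' i
          have h3 := hvH v i; have h4 := hvH v' i
          have h5 : (0:ℝ) ≤ (v i : ℕ) := by positivity
          have h6 : (0:ℝ) ≤ (v' i : ℕ) := by positivity
          have : |η i - η' i| ≤ 2 * H * ρ := by
            rw [abs_le]; constructor <;> nlinarith
          exact mul_le_mul this (hA i) (abs_nonneg _) (by positivity)
      _ = n * (2 * H * ρ) * A := by simp; ring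
      _ ≤ _ := hsmall
  have hzz : z = z' := by
    have h1 : |((z - z' : ℤ) : ℝ)| < 1 := by
      push_cast
      rw [abs_lt] at hz hz' ⊢
      rw [abs_le] at hdiff
      constructor <;> linarith [hz.1, hz.2, hz'.1, hz'.2, hdiff.1, hdiff.2]
    have h2 : |z - z'| < 1 := by exact_mod_cast h1
    have := Int.abs_lt_one_iff.mp h2
    omega
  subst hzz
  have hmain : |∑ i, η i * y i - ∑ i, η' i * y i| < 2 * c := by
    rw [abs_lt] at hz hz' ⊢
    constructor <;> linarith [hz.1, hz.2, hz'.1, hz'.2]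
  have hdec : ∑ i, η i * (y i : ℝ) - ∑ i, η' i * y i
      = 2 * ρ * ((v j : ℕ) - (v' j : ℕ)) * y j
        + ∑ i, ((η i - 2 * ρ * (v i : ℕ)) - (η' i - 2 * ρ * (v' i : ℕ))) * y i := by
    have : ∑ i, 2 * ρ * (((v i : ℕ) : ℝ) - (v' i : ℕ)) * y i
        = 2 * ρ * ((v j : ℕ) - (v' j : ℕ)) * y j := by
      refine Finset.sum_eq_single j (fun i _ hi => ?_) (by simp)
      rw [hF2 i hi]; ring
    rw [← this, ← Finset.sum_sub_distrib, ← Finset.sum_add_distrib]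
    refine Finset.sum_congr rfl fun i _ => by ring
  have herr : |∑ i, ((η i - 2 * ρ * (v i : ℕ)) - (η' i - 2 * ρ * (v' i : ℕ))) * (y i : ℝ)|
      ≤ n * (ρ * A) := by
    refine (Finset.abs_sum_le_sum_abs _ _).trans ?_
    calc _ ≤ ∑ i : Fin n, ρ * A := by
          refine Finset.sum_le_sum fun i _ => ?_
          rw [abs_mul]
          have h1 := hη i; have h2 := hη' i
          have : |(η i - 2 * ρ * (v i : ℕ)) - (η' i - 2 * ρ * (v' i : ℕ))| ≤ ρ := by
            rw [abs_le]; constructor <;> linarith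
          exact mul_le_mul this (hA i) (abs_nonneg _) hρ.le
      _ = _ := by simp
  have h2 : |2 * ρ * (((v j : ℕ) : ℝ) - (v' j : ℕ)) * y j| < (2 + n) * (ρ * A) := by
    have e : 2 * ρ * (((v j : ℕ) : ℝ) - (v' j : ℕ)) * y j
      = (∑ i, η i * (y i : ℝ) - ∑ i, η' i * y i) -
        ∑ i, ((η i - 2 * ρ * (v i : ℕ)) - (η' i - 2 * ρ * (v' i : ℕ))) * (y i : ℝ) := by
      rw [hdec]; ring
    rw [e]
    refine (abs_sub _ _).trans_lt ?_
    linarith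
  have h3 : |(((v j : ℕ) : ℝ) - (v' j : ℕ))| < n + 1 := by
    rw [abs_mul, abs_mul, hj, abs_of_pos (by positivity : 0 < 2 * ρ)] at h2
    have h4 : 0 < ρ * A := by positivity
    have h5 : (ρ * A) * (2 * |(((v j : ℕ) : ℝ) - (v' j : ℕ))|) < (ρ * A) * (2 + n) := by
      linarith
    have h6 := lt_of_mul_lt_mul_left h5 h4.le
    have : (0:ℝ) ≤ n := by positivity
    linarith
  have h4 : |((v j : ℕ) : ℤ) - (v' j : ℕ)| < n + 1 := by exact_mod_cast h3
  have h5 : ((v j : ℕ) : ℤ) - (v' j : ℕ) = 0 := by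
    apply Int.eq_zero_of_abs_lt_dvd (m := n + 1) _ h4
    have : (v' j : ℕ) ≡ (v j : ℕ) [MOD (n + 1)] := hF1.symm
    have := this.dvd
    push_cast at this
    exact this
  funext i
  by_cases hi : i = j
  · subst hi; apply Fin.ext; omega
  · exact hF2 i hi

/-- Sup norm of an integer vector, as a natural number. -/
def nrm {n : ℕ} (y : Fin n → ℤ) : ℕ := Finset.univ.sup fun j => (y j).natAbs

theorem natAbs_le_nrm {n : ℕ} (y : Fin n → ℤ) (j : Fin n) : (y j).natAbs ≤ nrm y :=
  Finset.le_sup (f := fun j => (y j).natAbs) (Finset.mem_univ j)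

theorem abs_le_nrm {n : ℕ} (y : Fin n → ℤ) (j : Fin n) : |(y j : ℝ)| ≤ nrm y := by
  have := natAbs_le_nrm y j
  rw [← Nat.cast_le (α := ℝ), Nat.cast_natAbs] at this
  simpa using this

theorem exists_abs_eq_nrm {n : ℕ} (hn : 0 < n) (y : Fin n → ℤ) :
    ∃ j, |(y j : ℝ)| = nrm y := by
  have : Nonempty (Fin n) := ⟨⟨0, hn⟩⟩
  obtain ⟨j, -, hj⟩ := Finset.exists_mem_eq_sup (Finset.univ : Finset (Fin n))
    Finset.univ_nonempty (fun j => (y j).natAbs)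
  refine ⟨j, ?_⟩
  rw [nrm, hj, Nat.cast_natAbs]
  simp

theorem nrm_pos {n : ℕ} {y : Fin n → ℤ} (hy : y ≠ 0) : 0 < nrm y := by
  obtain ⟨j, hj⟩ := Function.ne_iff.mp hy
  have := natAbs_le_nrm y j
  have : (y j).natAbs ≠ 0 := by simpa using hj
  omega

/-- Existence of many good children. -/
theorem good_children (n : ℕ) (hn : 0 < n) (V : ℕ) (Y : Set (Fin n → ℤ))
    (hV : ∀ a : ℕ, ∃ S : Finset (Fin n → ℤ), S.card ≤ V ∧
      ∀ y ∈ Y, 2 ^ a ≤ nrm y → nrm y < 2 ^ (a + 1) → y ∈ S)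
    (u : ℕ) (hu : 2 ≤ u) (huV : 2 * ((u + 1) * V * (n + 1)) ≤ 2 ^ u) (k : ℕ) (p : Fin n → ℝ) :
    ∃ f : Fin (2 ^ (n * u - 1)) → (Fin n → Fin (2 ^ u)), Function.Injective f ∧
      ∀ q, ∀ y ∈ Y, (2 ^ (u + 1)) ^ k ≤ nrm y → nrm y < (2 ^ (u + 1)) ^ (k + 1) →
        ∀ η : Fin n → ℝ, (∀ i, p i + 2 * (1 / (4 * n * (2 ^ (u + 1)) ^ (k + 2))) * (f q i : ℕ) ≤ η i ∧
          η i ≤ p i + 2 * (1 / (4 * n * (2 ^ (u + 1)) ^ (k + 2))) * (f q i : ℕ)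
            + 1 / (4 * n * (2 ^ (u + 1)) ^ (k + 2))) →
        ∀ z : ℤ, (1 / (4 * n * (2 ^ (u + 1)) ^ 2) : ℝ) ≤ |∑ i, η i * y i - z| := by
  classical
  have hn' : (1 : ℝ) ≤ n := by exact_mod_cast hn
  set R : ℝ := 2 ^ (u + 1) with hR
  have hR1 : 1 ≤ R := one_le_pow₀ (by norm_num)
  set ρ : ℝ := 1 / (4 * n * R ^ (k + 2)) with hρ
  set c : ℝ := 1 / (4 * n * R ^ 2) with hc
  have hρ0 : 0 < ρ := by positivity
  choose S hSV hS using hV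
  let T : Finset (Fin n → ℤ) := ((Finset.range (u + 1)).biUnion fun b => S ((u + 1) * k + b)).filter
    fun y => (2 ^ (u + 1)) ^ k ≤ nrm y ∧ nrm y < (2 ^ (u + 1)) ^ (k + 1)
  have hTcard : T.card ≤ (u + 1) * V := by
    refine (Finset.card_filter_le _ _).trans ?_
    refine (Finset.card_biUnion_le).trans ?_
    refine (Finset.sum_le_sum fun b _ => hSV _).trans ?_
    simp
  have hT : ∀ y ∈ Y, (2 ^ (u + 1)) ^ k ≤ nrm y → nrm y < (2 ^ (u + 1)) ^ (k + 1) → y ∈ T := by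
    intro y hy h1 h2
    simp only [T, Finset.mem_filter, Finset.mem_biUnion, Finset.mem_range]
    refine ⟨?_, h1, h2⟩
    have hpos : nrm y ≠ 0 := by
      have : 0 < (2 ^ (u + 1)) ^ k := by positivity
      omega
    rw [← pow_mul] at h1 h2
    have h3 : (u + 1) * k ≤ Nat.log 2 (nrm y) := Nat.le_log_of_pow_le (by norm_num) h1
    have h4 : Nat.log 2 (nrm y) < (u + 1) * (k + 1) := Nat.log_lt_of_lt_pow hpos h2
    refine ⟨Nat.log 2 (nrm y) - (u + 1) * k, ?_, ?_⟩
    · rw [mul_add] at h4; omega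
    · rw [Nat.add_sub_cancel' h3]
      exact hS _ y hy (Nat.pow_log_le_self 2 hpos) (Nat.lt_pow_succ_log_self (by norm_num) _)
  let badOf : (Fin n → ℤ) → Finset (Fin n → Fin (2 ^ u)) := fun y => Finset.univ.filter fun v =>
    ∃ η : Fin n → ℝ, (∀ i, p i + 2 * ρ * (v i : ℕ) ≤ η i ∧
      η i ≤ p i + 2 * ρ * (v i : ℕ) + ρ) ∧ ∃ z : ℤ, |∑ i, η i * y i - z| < c
  have hbadOf : ∀ y ∈ T, (badOf y).card ≤ (n + 1) * (2 ^ u) ^ (n - 1) := by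
    intro y hy
    simp only [T, Finset.mem_filter] at hy
    obtain ⟨-, h1, h2⟩ := hy
    obtain ⟨j, hj⟩ := exists_abs_eq_nrm hn y
    have h1' : R ^ k ≤ nrm y := by rw [hR]; exact_mod_cast h1
    have h2' : (nrm y : ℝ) ≤ R ^ (k + 1) := by rw [hR]; exact_mod_cast h2.le
    have hRk : 0 < R ^ k := by positivity
    refine count_bad n (2 ^ u) p ρ c (nrm y) y j hj (abs_le_nrm y) (hRk.trans_le h1') hρ0 ?_ ?_ ?_
      (badOf y) ?_
    · have : c = ρ * R ^ k := by
        rw [hc, hρ, pow_add]; field_simp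
      rw [this]; gcongr
    · rw [hc]
      apply one_div_le_one_div_of_le (by norm_num)
      have : 1 ≤ R ^ 2 := one_le_pow₀ hR1
      nlinarith
    · calc (n : ℝ) * (2 * ((2 ^ u : ℕ) : ℝ) * ρ) * nrm y
            ≤ n * (2 * ((2 ^ u : ℕ) : ℝ) * ρ) * R ^ (k + 1) := by gcongr
        _ = 1 / 4 := by
          have : 2 * ((2 ^ u : ℕ) : ℝ) = R := by rw [hR]; push_cast; ring
          rw [this, hρ, pow_succ R (k + 1)]
          field_simp
        _ ≤ 1 / 4 := le_rfl
    · intro v hv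
      simpa [badOf] using hv
  let bad := T.biUnion badOf
  have hbad : bad.card ≤ (u + 1) * V * ((n + 1) * (2 ^ u) ^ (n - 1)) := by
    refine (Finset.card_biUnion_le).trans ?_
    refine (Finset.sum_le_card_nsmul _ _ _ hbadOf).trans ?_
    rw [smul_eq_mul]
    gcongr
  have hpow : (2 ^ u) ^ n = 2 ^ u * (2 ^ u) ^ (n - 1) := by
    rw [← pow_succ', Nat.sub_add_cancel hn]
  have hpow2 : (2 ^ u) ^ n = 2 * 2 ^ (n * u - 1) := by
    have : 1 ≤ n * u := Nat.mul_pos hn (by omega)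
    rw [← pow_succ', Nat.sub_add_cancel this, ← pow_mul, mul_comm]
  have hgood : 2 ^ (n * u - 1) ≤ badᶜ.card := by
    rw [Finset.card_compl]
    simp only [Fintype.card_pi, Fintype.card_fin, Finset.prod_const, Finset.card_univ]
    have : 2 * bad.card ≤ (2 ^ u) ^ n := by
      calc 2 * bad.card ≤ 2 * ((u + 1) * V * ((n + 1) * (2 ^ u) ^ (n - 1))) := by gcongr
        _ = 2 * ((u + 1) * V * (n + 1)) * (2 ^ u) ^ (n - 1) := by ring
        _ ≤ 2 ^ u * (2 ^ u) ^ (n - 1) := by gcongr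
        _ = _ := hpow.symm
    omega
  have hemb : Nonempty (Fin (2 ^ (n * u - 1)) ↪ {v // v ∈ badᶜ}) := by
    apply Function.Embedding.nonempty_of_card_le
    rw [Fintype.card_fin, Fintype.card_coe]
    exact hgood
  obtain ⟨e⟩ := hemb
  refine ⟨fun q => (e q).1, fun a b hab => e.injective (Subtype.ext hab), ?_⟩
  intro q y hy h1 h2 η hη z
  by_contra! hlt
  have hq := (e q).2
  rw [Finset.mem_compl] at hq
  apply hq
  simp only [bad, Finset.mem_biUnion]
  refine ⟨y, hT y hy h1 h2, ?_⟩
  simp only [badOf, Finset.mem_filter, Finset.mem_univ, true_and]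
  exact ⟨η, hη, z, hlt⟩

theorem cantor_aux (n : ℕ) (hn : 0 < n) (V : ℕ) (Y : Set (Fin n → ℤ)) (hY : ∀ y ∈ Y, y ≠ 0)
    (hV : ∀ a : ℕ, ∃ S : Finset (Fin n → ℤ), S.card ≤ V ∧
      ∀ y ∈ Y, 2 ^ a ≤ nrm y → nrm y < 2 ^ (a + 1) → y ∈ S)
    (u : ℕ) (hu : 2 ≤ u) (huV : 2 * ((u + 1) * V * (n + 1)) ≤ 2 ^ u) (s : ℝ≥0)
    (hs : 0 < s) (hs' : (s : ℝ) * (u + 1) ≤ n * u - 1) :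
    (s : ℝ≥0∞) ≤ dimH {η : Fin n → ℝ | ∃ c : ℝ, 0 < c ∧
      ∀ y ∈ Y, ∀ z : ℤ, c ≤ |∑ i, η i * y i - z|} := by
  have hn' : (1 : ℝ) ≤ n := by exact_mod_cast hn
  have hgc := good_children n hn V Y hV u hu huV
  set Q := 2 ^ (n * u - 1) with hQ
  set R : ℝ := 2 ^ (u + 1) with hR
  choose f hfinj hf using hgc
  have hR1 : 1 < R := one_lt_pow₀ (by norm_num) (by omega)
  have hR0 : 0 < R := by positivity
  let r : ℕ → ℝ := fun k => 1 / (4 * n * R ^ (k + 1))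
  have hr0 : ∀ k, 0 < r k := fun k => by positivity
  have hrr : ∀ k, r k = R * r (k + 1) := fun k => by
    simp only [r]; rw [pow_succ R (k + 1)]; field_simp
  let P : (ℕ → Fin Q) → ℕ → (Fin n → ℝ) := fun ω k =>
    Nat.rec (fun _ => 0) (fun k p i => p i + 2 * r (k + 1) * (f k p (ω k) i : ℕ)) k
  have hP : ∀ ω k i, P ω (k + 1) i = P ω k i + 2 * r (k + 1) * (f k (P ω k) (ω k) i : ℕ) :=
    fun ω k i => rfl
  let φ : (ℕ → Fin Q) → (Fin n → ℝ) := fun ω i => ⨆ k, P ω k i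
  have hφ : ∀ ω k i, P ω k i ≤ φ ω i ∧ φ ω i ≤ P ω k i + r k := by
    intro ω k i
    have h1 : Monotone fun k => P ω k i := by
      refine monotone_nat_of_le_succ fun k => ?_
      rw [hP]
      have := hr0 (k + 1)
      have : 0 ≤ 2 * r (k + 1) * (f k (P ω k) (ω k) i : ℕ) := by positivity
      linarith
    have h2 : Antitone fun k => P ω k i + r k := by
      refine antitone_nat_of_succ_le fun k => ?_
      rw [hP, hrr k]
      have h3 : ((f k (P ω k) (ω k) i : ℕ) : ℝ) + 1 ≤ (2 : ℝ) ^ u := by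
        exact_mod_cast (f k (P ω k) (ω k) i).2
      have h4 : R = 2 * 2 ^ u := by rw [hR]; ring
      have h5 := hr0 (k + 1)
      rw [h4]
      nlinarith
    have := Monotone.ciSup_mem_iInter_Icc_of_antitone h1 h2
      (fun k => by have := hr0 k; simp only; linarith)
    exact Set.mem_iInter.1 this k
  have hPcongr : ∀ ω ω' k, (∀ i < k, ω i = ω' i) → P ω k = P ω' k := by
    intro ω ω' k
    induction k with
    | zero => intro _; rfl
    | succ k ih =>
      intro h
      have h1 := ih fun i hi => h i (by omega)
      funext i
      rw [hP, hP, h1, h k (by omega)]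
  have hdim : (s : ℝ≥0∞) ≤ dimH (Set.range φ) := by
    have hnu : 4 ≤ n * u + 3 - 1 := by
      have : 2 ≤ n * u := by nlinarith
      omega
    have hnu2 : 2 ≤ n * u := by nlinarith
    refine coding_dimH Q (Nat.one_lt_pow (by omega) (by norm_num)) φ R (r 1) hR0 (hr0 1) s hs ?_ ?_
    · rw [hR, hQ, ← Real.rpow_natCast, ← Real.rpow_mul (by norm_num)]
      push_cast
      rw [← Real.rpow_natCast]
      apply Real.rpow_le_rpow_of_exponent_le (by norm_num)
      rw [Nat.cast_sub (by omega)]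
      push_cast
      linarith
    · intro ω ω' k h1 h2
      have hp := hPcongr ω ω' k h1
      have hne : f k (P ω k) (ω k) ≠ f k (P ω' k) (ω' k) := by
        rw [hp]; exact fun h => h2 (hfinj _ _ h)
      obtain ⟨i, hi⟩ := Function.ne_iff.mp hne
      have hi' : ((f k (P ω k) (ω k) i : ℕ)) ≠ (f k (P ω' k) (ω' k) i : ℕ) :=
        fun h => hi (Fin.ext h)
      have e1 := hφ ω (k + 1) i
      have e2 := hφ ω' (k + 1) i
      rw [hP] at e1 e2
      have hpi : P ω k i = P ω' k i := congrFun hp i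
      have hrk := hr0 (k + 1)
      have : r 1 * (R ^ k)⁻¹ = r (k + 1) := by
        simp only [r]; field_simp; ring
      rw [this]
      refine le_trans ?_ (dist_le_pi_dist (φ ω) (φ ω') i)
      rw [Real.dist_eq]
      rcases lt_or_gt_of_ne hi' with hlt | hlt
      · have : ((f k (P ω k) (ω k) i : ℕ) : ℝ) + 1 ≤ (f k (P ω' k) (ω' k) i : ℕ) := by
          exact_mod_cast hlt
        rw [abs_sub_comm]
        refine le_trans ?_ (le_abs_self _)
        nlinarith
      · have : ((f k (P ω' k) (ω' k) i : ℕ) : ℝ) + 1 ≤ (f k (P ω k) (ω k) i : ℕ) := by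
          exact_mod_cast hlt
        refine le_trans ?_ (le_abs_self _)
        nlinarith
  refine hdim.trans (dimH_mono ?_)
  rintro _ ⟨ω, rfl⟩
  refine ⟨1 / (4 * n * R ^ 2), by positivity, fun y hy z => ?_⟩
  have hpos := nrm_pos (hY y hy)
  have hb : 1 < 2 ^ (u + 1) := Nat.one_lt_pow (by omega) (by norm_num)
  let k := Nat.log (2 ^ (u + 1)) (nrm y)
  refine hf k (P ω k) (ω k) y hy (Nat.pow_log_le_self _ hpos.ne')
    (Nat.lt_pow_succ_log_self hb _) (φ ω) (fun i => ?_) z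
  have := hφ ω (k + 1) i
  rw [hP] at this
  exact this

theorem cantor_dim (n : ℕ) (hn : 0 < n) (V : ℕ) (Y : Set (Fin n → ℤ)) (hY : ∀ y ∈ Y, y ≠ 0)
    (hV : ∀ a : ℕ, ∃ S : Finset (Fin n → ℤ), S.card ≤ V ∧
      ∀ y ∈ Y, 2 ^ a ≤ nrm y → nrm y < 2 ^ (a + 1) → y ∈ S)
    (s : ℝ≥0) (hs : 0 < s) (hsn : s < n) :
    (s : ℝ≥0∞) ≤ dimH {η : Fin n → ℝ | ∃ c : ℝ, 0 < c ∧
      ∀ y ∈ Y, ∀ z : ℤ, c ≤ |∑ i, η i * y i - z|} := by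
  have hsn' : (s : ℝ) < n := by exact_mod_cast hsn
  have h1 : ∀ᶠ u : ℕ in atTop, 2 * ((u + 1) * V * (n + 1)) ≤ 2 ^ u := by
    have h := tendsto_pow_const_div_const_pow_of_one_lt 1 (one_lt_two (α := ℝ))
    have hpos : (0 : ℝ) < 1 / (4 * (V + 1) * (n + 1)) := by positivity
    filter_upwards [h.eventually_lt_const hpos, eventually_ge_atTop 1] with u hu hu1
    rw [div_lt_div_iff₀ (by positivity) (by positivity)] at hu
    have hu' : u ^ 1 * (4 * (V + 1) * (n + 1)) < 1 * 2 ^ u := by exact_mod_cast hu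
    have : (u + 1) * V * (n + 1) ≤ (2 * u) * (V + 1) * (n + 1) := by
      gcongr <;> omega
    nlinarith
  have h2 : ∀ᶠ u : ℕ in atTop, (n + 1) / (n - (s : ℝ)) ≤ u :=
    tendsto_natCast_atTop_atTop.eventually_ge_atTop _
  obtain ⟨u, hu1, hu2, hu3⟩ := (h1.and (h2.and (eventually_ge_atTop 2))).exists
  refine cantor_aux n hn V Y hY hV u hu3 hu1 s hs ?_
  rw [div_le_iff₀ (by linarith)] at hu2
  nlinarith

/-- The transposed system of linear forms. -/
noncomputable def tform {m n : ℕ} (Θ : Fin m → Fin n → ℝ) (i : Fin m) (y : Fin n → ℤ) : ℝ :=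
  ∑ j, Θ i j * y j

theorem tform_sub {m n : ℕ} (Θ : Fin m → Fin n → ℝ) (i : Fin m) (y y' : Fin n → ℤ) :
    tform Θ i (y - y') = tform Θ i y - tform Θ i y' := by
  simp only [tform, ← Finset.sum_sub_distrib]
  refine Finset.sum_congr rfl fun j _ => ?_
  simp only [Pi.sub_apply]; push_cast; ring

/-- `y` approximates well at scale `k`. -/
def Approx {m n : ℕ} (Θ : Fin m → Fin n → ℝ) (k : ℕ) (y : Fin n → ℤ) : Prop :=
  y ≠ 0 ∧ ∀ i, |tform Θ i y - round (tform Θ i y)| ≤ ((2 : ℝ) ^ (n * k))⁻¹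

/-- Dirichlet's theorem for the transposed system. -/
theorem dirichlet {m n : ℕ} (hn : 0 < n) (Θ : Fin m → Fin n → ℝ) (k : ℕ) :
    ∃ y, Approx Θ k y ∧ nrm y ≤ 2 ^ (m * k) := by
  let F : (Fin n → Fin (2 ^ (m * k) + 1)) → (Fin m → Fin (2 ^ (n * k))) := fun a i =>
    ⟨⌊Int.fract (tform Θ i (fun j => ((a j : ℕ) : ℤ))) * 2 ^ (n * k)⌋₊, by
      rw [Nat.floor_lt (by positivity)]
      push_cast
      have := Int.fract_lt_one (tform Θ i (fun j => ((a j : ℕ) : ℤ)))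
      have h2 : (0:ℝ) < 2 ^ (n * k) := by positivity
      nlinarith⟩
  have hcard : Fintype.card (Fin m → Fin (2 ^ (n * k)))
      < Fintype.card (Fin n → Fin (2 ^ (m * k) + 1)) := by
    simp only [Fintype.card_pi, Fintype.card_fin, Finset.prod_const, Finset.card_univ]
    calc (2 ^ (n * k)) ^ m = (2 ^ (m * k)) ^ n := by
          rw [← pow_mul, ← pow_mul]; congr 1; ring
      _ < _ := Nat.pow_lt_pow_left (by omega) (by omega)
  obtain ⟨a, b, hab, hF⟩ := Fintype.exists_ne_map_eq_of_card_lt F hcard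
  let a' : Fin n → ℤ := fun j => ((a j : ℕ) : ℤ)
  let b' : Fin n → ℤ := fun j => ((b j : ℕ) : ℤ)
  refine ⟨a' - b', ⟨?_, ?_⟩, ?_⟩
  · intro h
    apply hab
    funext j
    have : a' j - b' j = 0 := congrFun h j
    apply Fin.ext
    simp only [a', b'] at this
    omega
  · intro i
    have h1 : ⌊Int.fract (tform Θ i a') * 2 ^ (n * k)⌋₊ = ⌊Int.fract (tform Θ i b') * 2 ^ (n * k)⌋₊ := by
      have := congrArg (fun q : Fin (2 ^ (n * k)) => (q : ℕ)) (congrFun hF i)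
      exact this
    have hp : (0:ℝ) < 2 ^ (n * k) := by positivity
    have h2 := Nat.floor_le (a := Int.fract (tform Θ i a') * 2 ^ (n * k))
      (mul_nonneg (Int.fract_nonneg _) hp.le)
    have h3 := Nat.lt_floor_add_one (Int.fract (tform Θ i a') * 2 ^ (n * k))
    have h4 := Nat.floor_le (a := Int.fract (tform Θ i b') * 2 ^ (n * k))
      (mul_nonneg (Int.fract_nonneg _) hp.le)
    have h5 := Nat.lt_floor_add_one (Int.fract (tform Θ i b') * 2 ^ (n * k))
    rw [h1] at h2 h3
    have h6 : |Int.fract (tform Θ i a') - Int.fract (tform Θ i b')| ≤ ((2 : ℝ) ^ (n * k))⁻¹ := by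
      rw [← one_div, abs_le]
      have e := mul_one_div_cancel hp.ne'
      constructor
      · rw [neg_le_iff_add_nonneg, ← mul_nonneg_iff_of_pos_right hp]
        linarith
      · rw [le_div_iff₀ hp]
        linarith
    refine (round_le _ (⌊tform Θ i a'⌋ - ⌊tform Θ i b'⌋)).trans ?_
    rw [tform_sub]
    push_cast
    rw [← Int.self_sub_floor, ← Int.self_sub_floor] at h6
    refine le_trans (le_of_eq ?_) h6
    congr 1
    ring
  · refine Finset.sup_le fun j _ => ?_
    have h1 := (a j).2
    have h2 := (b j).2
    simp only [a', b', Pi.sub_apply]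
    omega

theorem exists_best {m n : ℕ} (hn : 0 < n) (Θ : Fin m → Fin n → ℝ) (k : ℕ) :
    ∃ y, Approx Θ k y ∧ nrm y ≤ 2 ^ (m * k) ∧ ∀ y', Approx Θ k y' → nrm y ≤ nrm y' := by
  classical
  obtain ⟨y0, h0, h0'⟩ := dirichlet hn Θ k
  have hex : ∃ N, ∃ y, Approx Θ k y ∧ nrm y = N := ⟨_, y0, h0, rfl⟩
  obtain ⟨y, hy, hyN⟩ := Nat.find_spec hex
  have hmin : ∀ y', Approx Θ k y' → nrm y ≤ nrm y' := fun y' hy' => by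
    rw [hyN]; exact Nat.find_min' hex ⟨y', hy', rfl⟩
  exact ⟨y, hy, (hmin _ h0).trans h0', hmin⟩

theorem best_close {m n : ℕ} (Θ : Fin m → Fin n → ℝ) (Y : ℕ → Fin n → ℤ)
    (hY : ∀ k, Approx Θ k (Y k)) (hmin : ∀ k y', Approx Θ k y' → nrm (Y k) ≤ nrm y')
    (N : ℕ) (k l : ℕ) (hkl : k ≤ l) (hN : N ≤ nrm (Y k)) (hN0 : 0 < N)
    (hclose : ∀ j, |Y k j - Y l j| < N)
    (hsign : ∀ i, 0 ≤ tform Θ i (Y k) - round (tform Θ i (Y k)) ↔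
      0 ≤ tform Θ i (Y l) - round (tform Θ i (Y l))) : Y k = Y l := by
  by_contra hne
  have hA : Approx Θ k (Y k - Y l) := by
    refine ⟨sub_ne_zero.mpr hne, fun i => ?_⟩
    refine (round_le _ (round (tform Θ i (Y k)) - round (tform Θ i (Y l)))).trans ?_
    rw [tform_sub]
    push_cast
    have h1 := (hY k).2 i
    have h2 := (hY l).2 i
    have h3 : ((2 : ℝ) ^ (n * l))⁻¹ ≤ ((2 : ℝ) ^ (n * k))⁻¹ := by
      gcongr
      norm_num
    have hs := hsign i
    rw [abs_le] at h1 h2 ⊢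
    by_cases h0 : 0 ≤ tform Θ i (Y k) - round (tform Θ i (Y k))
    · have h0' := hs.1 h0
      constructor <;> linarith
    · have h0' := fun h => h0 (hs.2 h)
      rw [not_le] at h0
      have h0' := not_le.1 h0'
      constructor <;> linarith
  have h1 := hmin k _ hA
  have h2 : nrm (Y k - Y l) < N := by
    rw [nrm, Finset.sup_lt_iff (by simpa using hN0)]
    intro j _
    have := abs_lt.1 (hclose j)
    simp only [Pi.sub_apply]
    omega
  omega

theorem best_lacunary {m n : ℕ} (Θ : Fin m → Fin n → ℝ) (Y : ℕ → Fin n → ℤ)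
    (hY : ∀ k, Approx Θ k (Y k)) (hmin : ∀ k y', Approx Θ k y' → nrm (Y k) ≤ nrm y') (a : ℕ) :
    ∃ S : Finset (Fin n → ℤ), S.card ≤ 4 ^ n * 2 ^ m ∧
      ∀ y ∈ Set.range Y, 2 ^ a ≤ nrm y → nrm y < 2 ^ (a + 1) → y ∈ S := by
  classical
  let G : Set (Fin n → ℤ) := {y | y ∈ Set.range Y ∧ 2 ^ a ≤ nrm y ∧ nrm y < 2 ^ (a + 1)}
  let F : (Fin n → ℤ) → (Fin n → Fin 4) × (Fin m → Bool) := fun y =>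
    (fun j => ⟨(y j / 2 ^ a + 2).toNat % 4, Nat.mod_lt _ (by norm_num)⟩,
      fun i => decide (0 ≤ tform Θ i y - round (tform Θ i y)))
  have hcell : ∀ y ∈ G, ∀ j, -2 ≤ y j / 2 ^ a ∧ y j / 2 ^ a < 2 := by
    rintro y ⟨-, -, h⟩ j
    have h1 := natAbs_le_nrm y j
    have h2 : (y j).natAbs < 2 ^ (a + 1) := by omega
    have h3 : |y j| < 2 ^ (a + 1) := by
      rw [Int.abs_eq_natAbs]; exact_mod_cast h2
    rw [abs_lt, pow_succ] at h3
    have hp : (0 : ℤ) < 2 ^ a := by positivity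
    constructor
    · rw [Int.le_ediv_iff_mul_le hp]; linarith
    · rw [Int.ediv_lt_iff_lt_mul hp]; linarith
  have hinj : Set.InjOn F G := by
    intro y hy y' hy' hF
    have hclose : ∀ j, |y j - y' j| < ((2 ^ a : ℕ) : ℤ) := by
      intro j
      have h1 : (y j / 2 ^ a + 2).toNat % 4 = (y' j / 2 ^ a + 2).toNat % 4 := by
        have := congrArg (fun q : Fin 4 => (q : ℕ)) (congrFun (congrArg Prod.fst hF) j)
        exact this
      have h2 := hcell y hy j
      have h3 := hcell y' hy' j
      have h4 : y j / 2 ^ a = y' j / 2 ^ a := by omega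
      have hp : (0 : ℤ) < 2 ^ a := by positivity
      have e1 := Int.mul_ediv_add_emod (y j) (2 ^ a)
      have e2 := Int.mul_ediv_add_emod (y' j) (2 ^ a)
      rw [h4] at e1
      have b1 := Int.emod_nonneg (y j) hp.ne'
      have b2 := Int.emod_lt_of_pos (y j) hp
      have b3 := Int.emod_nonneg (y' j) hp.ne'
      have b4 := Int.emod_lt_of_pos (y' j) hp
      push_cast
      rw [abs_lt]
      constructor <;> linarith
    have hsign : ∀ i, 0 ≤ tform Θ i y - round (tform Θ i y) ↔
        0 ≤ tform Θ i y' - round (tform Θ i y') := by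
      intro i
      have := congrFun (congrArg Prod.snd hF) i
      simpa only [F, decide_eq_decide] using this
    obtain ⟨⟨k, rfl⟩, hk, -⟩ := hy
    obtain ⟨⟨l, rfl⟩, hl, -⟩ := hy'
    rcases le_total k l with hkl | hkl
    · exact best_close Θ Y hY hmin (2 ^ a) k l hkl hk (by positivity) hclose hsign
    · refine (best_close Θ Y hY hmin (2 ^ a) l k hkl hl (by positivity) (fun j => ?_)
        fun i => (hsign i).symm).symm
      rw [abs_sub_comm]; exact hclose j
  have hfin : G.Finite := Set.Finite.of_finite_image (Set.toFinite _) hinj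
  refine ⟨hfin.toFinset, ?_, fun y hy h1 h2 => hfin.mem_toFinset.2 ⟨hy, h1, h2⟩⟩
  have hcard : Fintype.card ((Fin n → Fin 4) × (Fin m → Bool)) = 4 ^ n * 2 ^ m := by simp
  rw [← hcard, ← Finset.card_univ]
  refine Finset.card_le_card_of_injOn F (fun _ _ => Finset.mem_coe.2 (Finset.mem_univ _)) ?_
  simpa using hinj

theorem abs_sub_round_le_dnint (t : ℝ) : |t - round t| ≤ dnint t :=
  le_ciInf fun k => round_le t k

theorem transfer {m n : ℕ} (hm : 0 < m) (hn : 0 < n) (Θ : Fin m → Fin n → ℝ)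
    (Y : ℕ → Fin n → ℤ) (hY : ∀ k, Approx Θ k (Y k)) (hYn : ∀ k, nrm (Y k) ≤ 2 ^ (m * k))
    (η : Fin n → ℝ) (c : ℝ) (hc : 0 < c) (hηc : ∀ k, ∀ z : ℤ, c ≤ |∑ j, η j * Y k j - z|)
    (x : Fin m → ℤ) (D X : ℝ) (hX1 : 1 ≤ X) (hX : ∀ i, |(x i : ℝ)| ≤ X)
    (hD : ∀ j, dnint ((∑ i : Fin m, Θ i j * (x i : ℝ)) - η j) ≤ D) :
    (c / (2 * n)) ^ n * (c / (2 ^ (n + 1) * m)) ^ m ≤ D ^ n * X ^ m := by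
  have hm' : (1 : ℝ) ≤ m := by exact_mod_cast hm
  have hn' : (1 : ℝ) ≤ n := by exact_mod_cast hn
  have hD0 : 0 ≤ D := le_trans (abs_nonneg _)
    ((abs_sub_round_le_dnint _).trans (hD ⟨0, hn⟩))
  have hmain : ∀ k, c ≤ m * X * ((2 : ℝ) ^ (n * k))⁻¹ + n * 2 ^ (m * k) * D := by
    intro k
    let z : Fin m → ℤ := fun i => round (tform Θ i (Y k))
    let w : Fin n → ℤ := fun j => round ((∑ i : Fin m, Θ i j * (x i : ℝ)) - η j)
    have h := hηc k (∑ i, x i * z i - ∑ j, Y k j * w j)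
    have e : ∑ j, η j * (Y k j : ℝ) - ((∑ i, x i * z i - ∑ j, Y k j * w j : ℤ) : ℝ)
        = ∑ i, (x i : ℝ) * (tform Θ i (Y k) - z i)
          - ∑ j, (Y k j : ℝ) * (((∑ i : Fin m, Θ i j * (x i : ℝ)) - η j) - w j) := by
      have e1 : ∑ i, (x i : ℝ) * tform Θ i (Y k)
          = ∑ j, (Y k j : ℝ) * ∑ i : Fin m, Θ i j * (x i : ℝ) := by
        simp only [tform, Finset.mul_sum]
        rw [Finset.sum_comm]
        refine Finset.sum_congr rfl fun j _ => Finset.sum_congr rfl fun i _ => by ring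
      simp only [mul_sub, Finset.sum_sub_distrib, e1]
      push_cast
      have : ∑ j, η j * (Y k j : ℝ) = ∑ j, (Y k j : ℝ) * η j :=
        Finset.sum_congr rfl fun j _ => mul_comm _ _
      rw [this]; ring
    rw [e] at h
    refine h.trans ((abs_sub _ _).trans (add_le_add ?_ ?_))
    · refine (Finset.abs_sum_le_sum_abs _ _).trans ?_
      calc _ ≤ ∑ i : Fin m, X * ((2 : ℝ) ^ (n * k))⁻¹ := by
            refine Finset.sum_le_sum fun i _ => ?_
            rw [abs_mul]
            exact mul_le_mul (hX i) ((hY k).2 i) (abs_nonneg _) (by linarith)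
        _ = _ := by simp; ring
    · refine (Finset.abs_sum_le_sum_abs _ _).trans ?_
      calc _ ≤ ∑ j : Fin n, 2 ^ (m * k) * D := by
            refine Finset.sum_le_sum fun j _ => ?_
            rw [abs_mul]
            refine mul_le_mul ?_ ((abs_sub_round_le_dnint _).trans (hD j)) (abs_nonneg _)
              (by positivity)
            refine (abs_le_nrm _ _).trans ?_
            exact_mod_cast hYn k
        _ = _ := by simp; ring
  have hc2 : c ≤ 1 / 2 := (hηc 0 (round _)).trans (abs_sub_round _)
  -- choose the scale
  have hex : ∃ k : ℕ, m * X * ((2 : ℝ) ^ (n * k))⁻¹ ≤ c / 2 := by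
    obtain ⟨k, hk⟩ := pow_unbounded_of_one_lt (m * X / (c / 2)) (one_lt_two (α := ℝ))
    refine ⟨k, ?_⟩
    rw [div_lt_iff₀ (by positivity)] at hk
    rw [mul_inv_le_iff₀ (by positivity)]
    have : (2 : ℝ) ^ k ≤ 2 ^ (n * k) := pow_le_pow_right₀ (by norm_num) (Nat.le_mul_of_pos_left k hn)
    nlinarith
  classical
  obtain ⟨k, hk, hkmin⟩ : ∃ k : ℕ, m * X * ((2 : ℝ) ^ (n * k))⁻¹ ≤ c / 2 ∧
      ∀ l < k, ¬ (m * X * ((2 : ℝ) ^ (n * l))⁻¹ ≤ c / 2) :=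
    ⟨Nat.find hex, Nat.find_spec hex, fun l hl => Nat.find_min hex hl⟩
  have hk0 : k ≠ 0 := by
    rintro rfl
    simp at hk
    nlinarith
  obtain ⟨l, rfl⟩ := Nat.exists_eq_succ_of_ne_zero hk0
  have hl := hkmin l (Nat.lt_succ_self l)
  push Not at hl
  have h2 : (2 : ℝ) ^ (n * (l + 1)) * c ≤ 2 ^ (n + 1) * m * X := by
    rw [← div_eq_mul_inv, lt_div_iff₀ (by positivity)] at hl
    rw [mul_add, mul_one, pow_add, pow_succ]
    have : (0 : ℝ) < 2 ^ n := by positivity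
    nlinarith
  have h3 : c / (2 * n) ≤ 2 ^ (m * (l + 1)) * D := by
    rw [div_le_iff₀ (by positivity)]
    have := hmain (l + 1)
    simp only [Nat.succ_eq_add_one] at hk
    linarith
  have h4 : c / (2 ^ (n + 1) * m) * 2 ^ (n * (l + 1)) ≤ X := by
    rw [div_mul_eq_mul_div, div_le_iff₀ (by positivity)]
    linarith
  have h5 : (c / (2 * n)) ^ n ≤ (2 ^ (m * (l + 1)) * D) ^ n := by gcongr
  have h6 : (c / (2 ^ (n + 1) * m) * 2 ^ (n * (l + 1))) ^ m ≤ X ^ m := by gcongr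
  have e : ((2 : ℝ) ^ (m * (l + 1))) ^ n = (2 ^ (n * (l + 1))) ^ m := by
    rw [← pow_mul, ← pow_mul]; congr 1; ring
  rw [mul_pow, e] at h5
  rw [mul_pow] at h6
  calc (c / (2 * n)) ^ n * (c / (2 ^ (n + 1) * m)) ^ m
      ≤ ((2 ^ (n * (l + 1))) ^ m * D ^ n) * (c / (2 ^ (n + 1) * m)) ^ m := by gcongr
    _ = D ^ n * ((c / (2 ^ (n + 1) * m)) ^ m * (2 ^ (n * (l + 1))) ^ m) := by ring
    _ ≤ D ^ n * X ^ m := by gcongr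

/-- Kleinbock's theorem: the set of pairs `(Θ, η)` that are badly approximable
in the inhomogeneous sense has full Hausdorff dimension `mn + n`. -/
theorem kleinbock_full_dimension (m n : ℕ) (hm : 0 < m) (hn : 0 < n) :
    dimH {p : (Fin m → Fin n → ℝ) × (Fin n → ℝ) |
        0 < ⨅ x : {x : Fin m → ℤ // x ≠ 0},
            (⨆ j : Fin n, dnint ((∑ i : Fin m, p.1 i j * (x.val i : ℝ)) - p.2 j)) ^ n *
              (⨆ i : Fin m, (|x.val i| : ℝ)) ^ m} = (m * n + n : ℕ) := by
  set B := {p : (Fin m → Fin n → ℝ) × (Fin n → ℝ) |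
        0 < ⨅ x : {x : Fin m → ℤ // x ≠ 0},
            (⨆ j : Fin n, dnint ((∑ i : Fin m, p.1 i j * (x.val i : ℝ)) - p.2 j)) ^ n *
              (⨆ i : Fin m, (|x.val i| : ℝ)) ^ m} with hB
  have hrank : finrank ℝ (Fin m → Fin n → ℝ) = m * n := by
    rw [finrank_pi_fintype]; simp
  apply le_antisymm
  · refine (dimH_mono (Set.subset_univ B)).trans ?_
    rw [Real.dimH_univ_eq_finrank, finrank_prod, hrank, finrank_fin_fun]
  have hslice : ∀ Θ : Fin m → Fin n → ℝ, ∀ s : ℝ≥0, 0 < s → s < n →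
      (s : ℝ≥0∞) ≤ dimH {η | (Θ, η) ∈ B} := by
    intro Θ s hs hsn
    choose Y hY hYn hYmin using exists_best hn Θ
    refine (cantor_dim n hn (4 ^ n * 2 ^ m) (Set.range Y) ?_ (best_lacunary Θ Y hY hYmin)
      s hs hsn).trans (dimH_mono ?_)
    · rintro _ ⟨k, rfl⟩
      exact (hY k).1
    · rintro η ⟨c, hc, hηc⟩
      have : Nonempty {x : Fin m → ℤ // x ≠ 0} :=
        ⟨⟨fun _ => 1, fun h => by simpa using congrFun h ⟨0, hm⟩⟩⟩
      have hpos : 0 < (c / (2 * n)) ^ n * (c / (2 ^ (n + 1) * m)) ^ m := by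
        have : (0 : ℝ) < m := by exact_mod_cast hm
        have : (0 : ℝ) < n := by exact_mod_cast hn
        positivity
      refine hpos.trans_le (le_ciInf fun x => ?_)
      have hX : ∀ i, |(x.val i : ℝ)| ≤ ⨆ i : Fin m, (|x.val i| : ℝ) := fun i =>
        le_ciSup (f := fun i : Fin m => (|x.val i| : ℝ)) (Set.finite_range _).bddAbove i
      refine transfer hm hn Θ Y hY hYn η c hc (fun k z => hηc _ ⟨k, rfl⟩ z) x.val _ _ ?_ hX
        fun j => le_ciSup (f := fun j => dnint ((∑ i : Fin m, Θ i j * (x.val i : ℝ)) - η j))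
          (Set.finite_range _).bddAbove j
      obtain ⟨i, hi⟩ := Function.ne_iff.mp x.2
      refine le_trans ?_ (hX i)
      have : (1 : ℤ) ≤ |x.val i| := Int.one_le_abs hi
      exact_mod_cast this
  refine ENNReal.le_of_forall_nnreal_lt fun r hr => ?_
  have hr' : (r : ℝ) < m * n + n := by exact_mod_cast hr
  have hnpos : (0 : ℝ) < n := by exact_mod_cast hn
  -- pick `d` with `r ≤ m n + d`, `0 < d < n`
  obtain ⟨d0, hd1, hd2⟩ := exists_between (max_lt hnpos (by linarith : (r : ℝ) - m * n < n))
  have hd0 : 0 < d0 := (le_max_left _ _).trans_lt hd1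
  have hrd : (r : ℝ) - m * n < d0 := (le_max_right _ _).trans_lt hd1
  let d : ℝ≥0 := ⟨d0, hd0.le⟩
  have hd : 0 < d := hd0
  have hdn : d < n := by
    rw [← NNReal.coe_lt_coe]; exact_mod_cast hd2
  obtain ⟨s, hs1, hs2⟩ := exists_between hdn
  have h1 := slice_aux B d hd fun Θ => by
    have h2 : (d : ℝ≥0∞) < dimH {η | (Θ, η) ∈ B} :=
      lt_of_lt_of_le (by exact_mod_cast hs1) (hslice Θ s (hd.trans hs1) hs2)
    rw [hausdorffMeasure_of_lt_dimH h2]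
    simp
  refine le_trans ?_ h1
  rw [hrank]
  rw [ENNReal.coe_le_coe, ← NNReal.coe_le_coe]
  push_cast
  show (r : ℝ) ≤ m * n + d0
  linarith
end

section
/- Let m, n be positive integers. For any m×n real matrix Θ = (θ_{i,j}), the set 𝓑(Θ) of vectors (η_1, …, η_n) ∈ ℝ^n for which inf over x ∈ ℤ^m \ {0} of (max_{1≤j≤n} ‖L_j(x) − η_j‖)^n · (max_{1≤i≤m} |x_i|)^m > 0 has full Hausdorff dimension in ℝ^n, i.e. its Hausdorff dimension equals n. -/
/-- A digit-coded set whose coding is inverse Hölder has large Hausdorff dimension. -/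
lemma cantor_dim_s3 (n q : ℕ) (hq : 1 < q) (x : (ℕ → Fin n → Fin q) → (Fin n → ℝ))
    (C α : NNReal) (hα : 0 < α)
    (h : ∀ d e k, (∀ i < k, d i = e i) → d k ≠ e k →
      ((q : ℝ) ^ k)⁻¹ ≤ C * dist (x d) (x e) ^ (α : ℝ)) :
    (n : ENNReal) * α ≤ dimH (Set.range x) := by
  classical
  have hfirst : ∀ d e : ℕ → Fin n → Fin q, d ≠ e → ∃ k, (∀ i < k, d i = e i) ∧ d k ≠ e k := by
    intro d e hde
    have hex : ∃ k, d k ≠ e k := by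
      by_contra hcon
      push Not at hcon
      exact hde (funext hcon)
    exact ⟨Nat.find hex, fun i hi => by simpa using Nat.find_min hex hi, Nat.find_spec hex⟩
  have hinj : Function.Injective x := by
    intro d e hde
    by_contra hne
    obtain ⟨k, hk1, hk2⟩ := hfirst d e hne
    have h1 := h d e k hk1 hk2
    have hα' : (α : ℝ) ≠ 0 := by exact_mod_cast hα.ne'
    rw [hde, dist_self, Real.zero_rpow hα', mul_zero] at h1
    have : 0 < ((q : ℝ) ^ k)⁻¹ := by positivity
    linarith
  let F : (ℕ → Fin n → Fin q) → (Fin n → ℝ) := fun d j => Real.ofDigits (fun k => d k j)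
  have : Nonempty (ℕ → Fin n → Fin q) := ⟨fun _ _ => ⟨0, by omega⟩⟩
  let g : (Fin n → ℝ) → (Fin n → ℝ) := fun y => F (Function.invFun x y)
  have hg : ∀ d, g (x d) = F d := fun d => by
    simp only [g, Function.leftInverse_invFun hinj d]
  have hH : HolderOnWith C α g (Set.range x) := by
    rintro _ ⟨d, rfl⟩ _ ⟨e, rfl⟩
    rw [hg, hg]
    by_cases hde : d = e
    · simp [hde]
    obtain ⟨k, hk1, hk2⟩ := hfirst d e hde
    have h1 := h d e k hk1 hk2
    have h2 : dist (F d) (F e) ≤ ((q : ℝ) ^ k)⁻¹ := by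
      rw [dist_pi_le_iff (by positivity)]
      intro j
      rw [Real.dist_eq]
      exact Real.abs_ofDigits_sub_ofDigits_le (fun i hi => by rw [hk1 i hi])
    have h3 := h2.trans h1
    rw [edist_dist, edist_dist, ENNReal.ofReal_rpow_of_nonneg dist_nonneg (NNReal.coe_nonneg α)]
    have : (C : ENNReal) = ENNReal.ofReal (C : ℝ) := by simp
    rw [this, ← ENNReal.ofReal_mul (NNReal.coe_nonneg C)]
    exact ENNReal.ofReal_le_ofReal h3
  have h4 := hH.dimH_image_le hα
  have hsub : Set.Icc (0 : Fin n → ℝ) 1 ⊆ g '' Set.range x := by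
    intro y hy
    have : ∀ j, ∃ d : ℕ → Fin q, Real.ofDigits d = y j := by
      intro j
      obtain ⟨d, -, hd⟩ := Real.ofDigits_SurjOn hq (show y j ∈ Set.Icc (0:ℝ) 1 from ⟨hy.1 j, hy.2 j⟩)
      exact ⟨d, hd⟩
    choose D hD using this
    refine ⟨x (fun k j => D j k), ⟨_, rfl⟩, ?_⟩
    rw [hg]
    funext j
    exact hD j
  have hdim : dimH (Set.Icc (0 : Fin n → ℝ) 1) = n := by
    have hne : (interior (Set.Icc (0 : Fin n → ℝ) 1)).Nonempty := by
      refine ⟨fun _ => 1/2, ?_⟩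
      rw [← Set.pi_univ_Icc, interior_pi_set Set.finite_univ]
      intro j _
      simp only [Pi.zero_apply, Pi.one_apply, interior_Icc]
      constructor <;> norm_num
    rw [Real.dimH_of_nonempty_interior hne]
    simp
  have h5 := (dimH_mono hsub).trans h4
  rw [hdim] at h5
  rwa [ENNReal.le_div_iff_mul_le (Or.inl (by exact_mod_cast hα.ne')) (Or.inl (by simp))] at h5

/-- One step of the strategy: a sign pattern avoiding all resonances of `z`. -/
lemma sign_step (n : ℕ) (z : Fin n → ℤ) (c : Fin n → ℝ) (r : ℝ) (hr : 0 < r)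
    (hz : ∀ j, (n : ℝ) * |(z j : ℝ)| * r ≤ 1 / 4) :
    ∃ σ : Fin n → ℝ, (∀ j, σ j = 1 ∨ σ j = -1) ∧
      ∀ η : Fin n → ℝ, (∀ j, 3 / 16 * r ≤ σ j * (η j - c j)) →
        (∀ j, σ j * (η j - c j) ≤ 13 / 16 * r) →
        ∀ (p : ℤ) (j : Fin n), 3 / 16 * |(z j : ℝ)| * r ≤ |(∑ j, (z j : ℝ) * η j) - p| := by
  set v : ℝ := ∑ j, (z j : ℝ) * c j with hv
  set w : ℝ := v - round v with hw
  have hw2 : |w| ≤ 1 / 2 := abs_sub_round v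
  obtain ⟨τ, hτ, hτw⟩ : ∃ τ : ℝ, (τ = 1 ∨ τ = -1) ∧ |w| = τ * w := by
    rcases le_total 0 w with h | h
    · exact ⟨1, Or.inl rfl, by rw [abs_of_nonneg h]; ring⟩
    · exact ⟨-1, Or.inr rfl, by rw [abs_of_nonpos h]; ring⟩
  have hs : ∀ j, ∃ s : ℝ, (s = 1 ∨ s = -1) ∧ (z j : ℝ) = s * |(z j : ℝ)| := by
    intro j
    rcases le_total 0 (z j : ℝ) with h | h
    · exact ⟨1, Or.inl rfl, by rw [abs_of_nonneg h]; ring⟩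
    · exact ⟨-1, Or.inr rfl, by rw [abs_of_nonpos h]; ring⟩
  choose s hs1 hs2 using hs
  have hττ : τ * τ = 1 := by rcases hτ with h | h <;> rw [h] <;> norm_num
  refine ⟨fun j => τ * s j, fun j => ?_, fun η h1 h2 p j0 => ?_⟩
  · rcases hτ with h | h <;> rcases hs1 j with h' | h' <;> simp [h, h']
  set S : ℝ := ∑ j, |(z j : ℝ)| * (τ * s j * (η j - c j)) with hS
  have hsum : (∑ j, (z j : ℝ) * η j) = v + τ * S := by
    rw [hv, hS, Finset.mul_sum, ← Finset.sum_add_distrib]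
    refine Finset.sum_congr rfl fun j _ => ?_
    have : (z j : ℝ) * η j = z j * c j + (τ * τ) * (s j * |(z j : ℝ)|) * (η j - c j) := by
      rw [hττ, ← hs2 j]; ring
    rw [this]; ring
  have hpos : ∀ j, 0 ≤ |(z j : ℝ)| * (τ * s j * (η j - c j)) := fun j =>
    mul_nonneg (abs_nonneg _) (le_trans (by positivity) (h1 j))
  have hSl : 3 / 16 * |(z j0 : ℝ)| * r ≤ S := by
    calc 3 / 16 * |(z j0 : ℝ)| * r = |(z j0 : ℝ)| * (3 / 16 * r) := by ring
      _ ≤ |(z j0 : ℝ)| * (τ * s j0 * (η j0 - c j0)) :=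
        mul_le_mul_of_nonneg_left (h1 j0) (abs_nonneg _)
      _ ≤ S := Finset.single_le_sum (f := fun j => |(z j : ℝ)| * (τ * s j * (η j - c j)))
        (fun j _ => hpos j) (Finset.mem_univ j0)
  have hn : (0 : ℝ) < n := by exact_mod_cast (Fin.pos j0)
  have hSu : S ≤ 1 / 4 := by
    have : ∀ j ∈ Finset.univ, |(z j : ℝ)| * (τ * s j * (η j - c j)) ≤ 1 / (4 * n) := by
      intro j _
      have a1 := mul_le_mul_of_nonneg_left (h2 j) (abs_nonneg (z j : ℝ))
      have a2 := hz j
      have a3 : |(z j : ℝ)| * r ≤ 1 / (4 * n) := by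
        rw [le_div_iff₀ (by positivity)]; nlinarith
      have a4 : 0 ≤ |(z j : ℝ)| * r := by positivity
      nlinarith
    have := Finset.sum_le_sum this
    rw [Finset.sum_const, Finset.card_univ, Fintype.card_fin, nsmul_eq_mul] at this
    calc S ≤ _ := this
      _ = 1 / 4 := by field_simp
  have hS0 : 0 ≤ S := Finset.sum_nonneg fun j _ => hpos j
  refine hSl.trans ?_
  have e1 : (∑ j, (z j : ℝ) * η j) - p = w + τ * S - ((p - round v : ℤ) : ℝ) := by
    rw [hsum, hw]; push_cast; ring
  have e2 : |w + τ * S| = |w| + S := by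
    have : w + τ * S = τ * (|w| + S) := by
      rw [hτw]; linear_combination (-w) * hττ
    rw [this, abs_mul, abs_of_nonneg (add_nonneg (abs_nonneg w) hS0)]
    rcases hτ with h | h <;> simp [h]
  rw [e1]
  by_cases hp : p - round v = 0
  · rw [hp, Int.cast_zero, sub_zero, e2]
    linarith [abs_nonneg w]
  · have a1 : (1 : ℝ) ≤ |((p - round v : ℤ) : ℝ)| := by
      exact_mod_cast Int.one_le_abs hp
    have a2 := abs_sub_abs_le_abs_sub ((p - round v : ℤ) : ℝ) (w + τ * S)
    rw [abs_sub_comm] at a2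
    linarith

/-- The Cantor-type construction. -/
lemma cantor_exists (n q : ℕ) (hq : 1 < q) (ρ : ℝ) (hρ : 0 < ρ) (z : ℕ → Fin n → ℤ)
    (hz : ∀ k j, (n : ℝ) * |(z k j : ℝ)| * (ρ / (16 * q) ^ k) ≤ 1 / 4) :
    ∃ x : (ℕ → Fin n → Fin q) → (Fin n → ℝ),
      (∀ d k (p : ℤ) j, 3 / 16 * |(z k j : ℝ)| * (ρ / (16 * q) ^ k) ≤
        |(∑ j, (z k j : ℝ) * x d j) - p|) ∧
      ∀ d e k, (∀ i < k, d i = e i) → d k ≠ e k →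
        ρ / (16 * q) ^ k / (8 * q) ≤ dist (x d) (x e) := by
  have hq0 : (1 : ℝ) < q := by exact_mod_cast hq
  set r : ℕ → ℝ := fun k => ρ / (16 * q) ^ k with hr
  have hrpos : ∀ k, 0 < r k := fun k => by simp only [hr]; positivity
  have hrs : ∀ k, r (k + 1) = r k / (16 * q) := fun k => by
    simp only [hr]; rw [pow_succ]; field_simp
  have hrs' : ∀ k, r (k + 1) ≤ r k / 16 := fun k => by
    rw [hrs]
    have := hrpos k
    gcongr
    linarith
  choose σ hσ1 hσ2 using fun k c => sign_step n (z k) c (r k) (hrpos k) (hz k)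
  let c : (ℕ → Fin n → Fin q) → ℕ → (Fin n → ℝ) := fun d k =>
    Nat.rec (motive := fun _ => Fin n → ℝ) 0
      (fun k ck j => ck j + r k * (σ k ck j / 2 + ((d k j : ℕ) : ℝ) / (4 * q))) k
  have hc : ∀ d k j, c d (k + 1) j =
      c d k j + r k * (σ k (c d k) j / 2 + ((d k j : ℕ) : ℝ) / (4 * q)) := fun d k j => rfl
  have hdig : ∀ (a : Fin q), 0 ≤ ((a : ℕ) : ℝ) / (4 * q) ∧ ((a : ℕ) : ℝ) / (4 * q) ≤ 1 / 4 := by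
    intro a
    refine ⟨by positivity, ?_⟩
    have : ((a : ℕ) : ℝ) ≤ q := by exact_mod_cast a.2.le
    rw [div_le_iff₀ (by positivity)]
    linarith
  -- points near the next centre
  have hnear : ∀ d k (η : Fin n → ℝ), (∀ j, |η j - c d (k + 1) j| ≤ r (k + 1)) → ∀ j,
      3 / 16 * r k ≤ σ k (c d k) j * (η j - c d k j) ∧
      σ k (c d k) j * (η j - c d k j) ≤ 13 / 16 * r k := by
    intro d k η h j
    have h1 := abs_le.1 ((h j).trans (hrs' k))
    rw [hc] at h1
    obtain ⟨h2, h3⟩ := hdig (d k j)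
    have hrk := hrpos k
    have h4 := mul_le_mul_of_nonneg_left h3 hrk.le
    have h5 := mul_nonneg hrk.le h2
    rcases hσ1 k (c d k) j with h6 | h6 <;> rw [h6] at h1 ⊢ <;> constructor <;> nlinarith
  have hnest : ∀ d k (η : Fin n → ℝ), (∀ j, |η j - c d (k + 1) j| ≤ r (k + 1)) →
      ∀ j, |η j - c d k j| ≤ r k := by
    intro d k η h j
    obtain ⟨h1, h2⟩ := hnear d k η h j
    have hrk := hrpos k
    rw [abs_le]
    rcases hσ1 k (c d k) j with h6 | h6 <;> rw [h6] at h1 h2 <;> constructor <;> nlinarith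
  have hnest' : ∀ d k l (η : Fin n → ℝ), (∀ j, |η j - c d (k + l) j| ≤ r (k + l)) →
      ∀ j, |η j - c d k j| ≤ r k := by
    intro d k l
    induction l with
    | zero => intro η h; exact h
    | succ l ih => intro η h; exact ih η (hnest d (k + l) η h)
  have hx : ∀ d, ∃ η : Fin n → ℝ, ∀ k j, |η j - c d k j| ≤ r k := by
    intro d
    have hne := IsCompact.nonempty_iInter_of_sequence_nonempty_isCompact_isClosed
      (fun k => Metric.closedBall (c d k) (r k))
      (fun k => by
        intro η hη
        rw [Metric.mem_closedBall, dist_pi_le_iff (hrpos _).le] at hη ⊢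
        exact hnest d k η hη)
      (fun k => ⟨c d k, Metric.mem_closedBall_self (hrpos k).le⟩)
      (isCompact_closedBall _ _) (fun k => Metric.isClosed_closedBall)
    obtain ⟨η, hη⟩ := hne
    refine ⟨η, fun k => ?_⟩
    have := Set.mem_iInter.1 hη k
    rw [Metric.mem_closedBall, dist_pi_le_iff (hrpos _).le] at this
    exact this
  choose x hx using hx
  refine ⟨x, fun d k p j => ?_, fun d e k hde hk => ?_⟩
  · have h := hnear d k (x d) (hx d (k + 1))
    exact hσ2 k (c d k) (x d) (fun j => (h j).1) (fun j => (h j).2) p j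
  · have hcc : ∀ l ≤ k, c d l = c e l := by
      intro l
      induction l with
      | zero => intro _; rfl
      | succ l ih =>
        intro hl
        funext j
        rw [hc, hc, ih (by omega), hde l (by omega)]
    obtain ⟨j, hj⟩ := Function.ne_iff.1 hk
    have h1 := hx d (k + 1) j
    have h2 := hx e (k + 1) j
    refine le_trans ?_ (dist_le_pi_dist (x d) (x e) j)
    rw [Real.dist_eq]
    have hdiff : c d (k + 1) j - c e (k + 1) j =
        r k / (4 * q) * (((d k j : ℕ) : ℝ) - ((e k j : ℕ) : ℝ)) := by
      rw [hc, hc, hcc k le_rfl]; ring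
    have hone : (1 : ℝ) ≤ |((d k j : ℕ) : ℝ) - ((e k j : ℕ) : ℝ)| := by
      have : ((d k j : ℕ) : ℤ) - ((e k j : ℕ) : ℤ) ≠ 0 := by
        intro h
        apply hj
        apply Fin.ext
        omega
      exact_mod_cast Int.one_le_abs this
    have hrk := hrpos k
    have h3 : r k / (4 * q) ≤ |c d (k + 1) j - c e (k + 1) j| := by
      rw [hdiff, abs_mul, abs_of_pos (by positivity)]
      exact le_mul_of_one_le_right (by positivity) hone
    have h4 : |c d (k + 1) j - c e (k + 1) j| ≤
        |x d j - c d (k + 1) j| + |x d j - x e j| + |x e j - c e (k + 1) j| := by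
      have : c d (k + 1) j - c e (k + 1) j =
        -(x d j - c d (k + 1) j) + (x d j - x e j) + (x e j - c e (k + 1) j) := by ring
      rw [this]
      refine (abs_add_three _ _ _).trans ?_
      rw [abs_neg]
    have h5 : r k / (4 * q) = r k / (8 * q) + 2 * (r k / (16 * q)) := by
      field_simp; norm_num
    rw [hrs] at h1 h2
    change r k / (8 * q) ≤ _
    linarith

/-- Dirichlet's theorem for the transposed system. -/
lemma dirichlet_dual (m n Q B : ℕ) (hB : 0 < B) (hBQ : B ^ m < (Q + 1) ^ n)
    (θ : Fin m → Fin n → ℝ) :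
    ∃ y : Fin n → ℤ, y ≠ 0 ∧ (∀ j, |y j| ≤ (Q : ℤ)) ∧
      ∀ i, |(∑ j, θ i j * (y j : ℝ)) - round (∑ j, θ i j * (y j : ℝ))| ≤ (B : ℝ)⁻¹ := by
  have hB' : (0 : ℝ) < B := by exact_mod_cast hB
  let L : (Fin n → Fin (Q + 1)) → Fin m → ℝ := fun y i => ∑ j, θ i j * ((y j : ℕ) : ℝ)
  have hlt : ∀ t : ℝ, ⌊(B : ℝ) * Int.fract t⌋₊ < B := by
    intro t
    rw [Nat.floor_lt (by positivity)]
    nlinarith [Int.fract_lt_one t]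
  let f : (Fin n → Fin (Q + 1)) → (Fin m → Fin B) := fun y i =>
    ⟨⌊(B : ℝ) * Int.fract (L y i)⌋₊, hlt _⟩
  obtain ⟨y, y', hne, hf⟩ := Fintype.exists_ne_map_eq_of_card_lt f (by simpa using hBQ)
  refine ⟨fun j => ((y j : ℕ) : ℤ) - ((y' j : ℕ) : ℤ), ?_, ?_, ?_⟩
  · intro h
    apply hne
    funext j
    have := congrFun h j
    simp only [Pi.zero_apply] at this
    apply Fin.ext
    omega
  · intro j
    have := (y j).2
    have := (y' j).2
    simp only [abs_le]
    constructor <;> omega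
  · intro i
    have h1 : ⌊(B : ℝ) * Int.fract (L y i)⌋₊ = ⌊(B : ℝ) * Int.fract (L y' i)⌋₊ := by
      have := congrFun hf i
      simpa [f] using this
    have e : (∑ j, θ i j * (((((y j : ℕ) : ℤ) - ((y' j : ℕ) : ℤ) : ℤ)) : ℝ)) = L y i - L y' i := by
      simp only [L]
      rw [← Finset.sum_sub_distrib]
      refine Finset.sum_congr rfl fun j _ => ?_
      push_cast; ring
    rw [e]
    refine (round_le _ (⌊L y i⌋ - ⌊L y' i⌋)).trans ?_
    have e2 : L y i - L y' i - ((⌊L y i⌋ - ⌊L y' i⌋ : ℤ) : ℝ)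
        = Int.fract (L y i) - Int.fract (L y' i) := by
      simp only [Int.fract]; push_cast; ring
    rw [e2]
    have a1 := Nat.floor_le (show 0 ≤ (B : ℝ) * Int.fract (L y i) by positivity)
    have a2 := Nat.lt_floor_add_one ((B : ℝ) * Int.fract (L y i))
    have a3 := Nat.floor_le (show 0 ≤ (B : ℝ) * Int.fract (L y' i) by positivity)
    have a4 := Nat.lt_floor_add_one ((B : ℝ) * Int.fract (L y' i))
    rw [← h1] at a3 a4
    rw [← one_div, le_div_iff₀ hB', ← abs_of_pos hB', ← abs_mul, abs_le]
    constructor <;> nlinarith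

/-- One minimizing vector from each dyadic-type window. -/
lemma window_seq (n R : ℕ) (hn : 0 < n) (hR : 2 ≤ R) (M : (Fin n → ℤ) → ℝ) :
    ∃ z : ℕ → Fin n → ℤ, (∀ s j, |z s j| ≤ (R : ℤ) ^ s) ∧
      (∀ s, ∃ j, (R : ℤ) ^ s < R * |z s j|) ∧
      ∀ t y, y ≠ 0 → (∀ j, |y j| ≤ (R : ℤ) ^ t) → ∃ s ≤ t, M (z s) ≤ M y := by
  classical
  let W : ℕ → Set (Fin n → ℤ) := fun s =>
    {y | (∀ j, |y j| ≤ (R : ℤ) ^ s) ∧ ∃ j, (R : ℤ) ^ s < R * |y j|}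
  have hfin : ∀ s, (W s).Finite := by
    intro s
    refine (Set.finite_Icc (fun _ : Fin n => -(R : ℤ) ^ s) (fun _ => (R : ℤ) ^ s)).subset ?_
    intro y hy
    exact ⟨fun j => (abs_le.1 (hy.1 j)).1, fun j => (abs_le.1 (hy.1 j)).2⟩
  have hR' : (2 : ℤ) ≤ R := by exact_mod_cast hR
  have hne : ∀ s, (W s).Nonempty := by
    intro s
    have hp : (0 : ℤ) < (R : ℤ) ^ s := by positivity
    refine ⟨fun _ => (R : ℤ) ^ s, fun j => by rw [abs_of_pos hp], ⟨0, hn⟩, ?_⟩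
    rw [abs_of_pos hp]
    nlinarith
  choose z hz1 hz2 using fun s => Set.exists_min_image (W s) M (hfin s) (hne s)
  refine ⟨z, fun s => (hz1 s).1, fun s => (hz1 s).2, fun t y hy0 hy => ?_⟩
  have hex : ∃ s, ∀ j, |y j| ≤ (R : ℤ) ^ s := ⟨t, hy⟩
  refine ⟨Nat.find hex, Nat.find_min' hex hy, hz2 _ y ⟨Nat.find_spec hex, ?_⟩⟩
  rcases hs : Nat.find hex with _ | s
  · obtain ⟨j, hj⟩ := Function.ne_iff.1 hy0
    have := Int.one_le_abs hj
    refine ⟨j, ?_⟩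
    rw [pow_zero]
    nlinarith
  · have := Nat.find_min hex (m := s) (by omega)
    push Not at this
    obtain ⟨j, hj⟩ := this
    refine ⟨j, ?_⟩
    rw [pow_succ']
    nlinarith

/-- Transference: avoiding the dual resonances implies being badly approximable. -/
lemma transfer_s3 (m n : ℕ) (hm : 0 < m) (hn : 0 < n) (θ : Fin m → Fin n → ℝ) (S : ℕ) (hS : 2 ≤ S)
    (γ : ℝ) (hγ : 0 < γ) (η : Fin n → ℝ)
    (h : ∀ t : ℕ, ∃ z : Fin n → ℤ, (∀ j, |(z j : ℝ)| ≤ ((S : ℝ) ^ m) ^ t) ∧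
      (∀ i, |(∑ j, θ i j * (z j : ℝ)) - round (∑ j, θ i j * (z j : ℝ))| ≤
        ((S : ℝ) ^ (n * t))⁻¹) ∧
      ∀ p : ℤ, γ ≤ |(∑ j, (z j : ℝ) * η j) - p|) :
    0 < ⨅ x : {x : Fin m → ℤ // x ≠ 0},
            (⨆ j : Fin n, dnint ((∑ i : Fin m, θ i j * (x.val i : ℝ)) - η j)) ^ n *
              (⨆ i : Fin m, (|x.val i| : ℝ)) ^ m := by
  have hS' : (2 : ℝ) ≤ S := by exact_mod_cast hS
  have hm' : (0 : ℝ) < m := by exact_mod_cast hm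
  have hn' : (0 : ℝ) < n := by exact_mod_cast hn
  set A : ℝ := 1 + S ^ n * (2 * m) / γ with hA
  have hA0 : 0 < A := by positivity
  have : Nonempty {x : Fin m → ℤ // x ≠ 0} :=
    ⟨⟨fun _ => 1, fun hx => by simpa using congrFun hx ⟨0, hm⟩⟩⟩
  refine lt_of_lt_of_le (show 0 < (γ / (2 * n)) ^ n / A ^ m by positivity) (le_ciInf ?_)
  rintro ⟨x, hx0⟩
  simp only
  set X : ℝ := ⨆ i : Fin m, |(x i : ℝ)| with hX
  set D : ℝ := ⨆ j : Fin n, dnint ((∑ i : Fin m, θ i j * (x i : ℝ)) - η j) with hD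
  have hXi : ∀ i, |(x i : ℝ)| ≤ X := fun i => le_ciSup (f := fun i => |(x i : ℝ)|) (Set.finite_range _).bddAbove i
  have hX1 : 1 ≤ X := by
    obtain ⟨i, hi⟩ := Function.ne_iff.1 hx0
    refine le_trans ?_ (hXi i)
    exact_mod_cast Int.one_le_abs hi
  have hDj : ∀ j, |(∑ i : Fin m, θ i j * (x i : ℝ)) - η j
      - round ((∑ i : Fin m, θ i j * (x i : ℝ)) - η j)| ≤ D := fun j =>
    le_trans (le_ciInf fun k => round_le _ k)
      (le_ciSup (f := fun j => dnint ((∑ i : Fin m, θ i j * (x i : ℝ)) - η j))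
        (Set.finite_range _).bddAbove j)
  -- choice of the scale
  have hex : ∃ t : ℕ, 2 * m * X ≤ γ * (S : ℝ) ^ (n * t) := by
    obtain ⟨t, ht⟩ := pow_unbounded_of_one_lt (2 * m * X / γ) (show (1 : ℝ) < S by linarith)
    refine ⟨t, ?_⟩
    rw [div_lt_iff₀ hγ] at ht
    have : (S : ℝ) ^ t ≤ S ^ (n * t) :=
      pow_le_pow_right₀ (by linarith) (Nat.le_mul_of_pos_left t hn)
    nlinarith
  obtain ⟨t, ht1, ht2⟩ : ∃ t : ℕ, 2 * m * X ≤ γ * (S : ℝ) ^ (n * t) ∧ (S : ℝ) ^ (n * t) ≤ A * X := by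
    classical
    refine ⟨Nat.find hex, Nat.find_spec hex, ?_⟩
    have hq : 0 ≤ (S : ℝ) ^ n * (2 * m) / γ := by positivity
    rcases hs : Nat.find hex with _ | s
    · rw [mul_zero, pow_zero, hA]
      nlinarith
    · have := Nat.find_min hex (m := s) (by omega)
      push Not at this
      rw [mul_add, mul_one, pow_add, hA]
      have h1 : (S : ℝ) ^ (n * s) ≤ 2 * m * X / γ := by
        rw [le_div_iff₀ hγ]; linarith
      calc (S : ℝ) ^ (n * s) * S ^ n ≤ 2 * m * X / γ * S ^ n := by gcongr
        _ = S ^ n * (2 * m) / γ * X := by ring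
        _ ≤ _ := by nlinarith
  obtain ⟨z, hz1, hz2, hz3⟩ := h t
  have key := hz3 ((∑ i, x i * round (∑ j, θ i j * (z j : ℝ)))
    - ∑ j, z j * round ((∑ i : Fin m, θ i j * (x i : ℝ)) - η j))
  have ident : (∑ j, (z j : ℝ) * η j) - (((∑ i, x i * round (∑ j, θ i j * (z j : ℝ)))
    - ∑ j, z j * round ((∑ i : Fin m, θ i j * (x i : ℝ)) - η j) : ℤ) : ℝ) =
      (∑ i, (x i : ℝ) * ((∑ j, θ i j * (z j : ℝ)) - round (∑ j, θ i j * (z j : ℝ)))) -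
      ∑ j, (z j : ℝ) * ((∑ i : Fin m, θ i j * (x i : ℝ)) - η j
        - round ((∑ i : Fin m, θ i j * (x i : ℝ)) - η j)) := by
    push_cast
    simp only [mul_sub, Finset.sum_sub_distrib, Finset.mul_sum]
    have : (∑ i, ∑ j, (x i : ℝ) * (θ i j * (z j : ℝ))) =
        ∑ j, ∑ i, (z j : ℝ) * (θ i j * (x i : ℝ)) := by
      rw [Finset.sum_comm]
      refine Finset.sum_congr rfl fun j _ => Finset.sum_congr rfl fun i _ => ?_
      ring
    rw [this]; ring
  rw [ident] at key
  have hSp : (0 : ℝ) < (S : ℝ) ^ (n * t) := by positivity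
  have b1 : |∑ i, (x i : ℝ) * ((∑ j, θ i j * (z j : ℝ)) - round (∑ j, θ i j * (z j : ℝ)))| ≤
      m * (X * ((S : ℝ) ^ (n * t))⁻¹) := by
    refine (Finset.abs_sum_le_sum_abs _ _).trans ?_
    have : ∀ i ∈ Finset.univ, |(x i : ℝ) * ((∑ j, θ i j * (z j : ℝ)) -
        round (∑ j, θ i j * (z j : ℝ)))| ≤ X * ((S : ℝ) ^ (n * t))⁻¹ := by
      intro i _
      rw [abs_mul]
      exact mul_le_mul (hXi i) (hz2 i) (abs_nonneg _) (by linarith)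
    simpa using Finset.sum_le_sum this
  have b2 : |∑ j, (z j : ℝ) * ((∑ i : Fin m, θ i j * (x i : ℝ)) - η j
        - round ((∑ i : Fin m, θ i j * (x i : ℝ)) - η j))| ≤ n * (((S : ℝ) ^ m) ^ t * D) := by
    refine (Finset.abs_sum_le_sum_abs _ _).trans ?_
    have : ∀ j ∈ Finset.univ, |(z j : ℝ) * ((∑ i : Fin m, θ i j * (x i : ℝ)) - η j
        - round ((∑ i : Fin m, θ i j * (x i : ℝ)) - η j))| ≤ ((S : ℝ) ^ m) ^ t * D := by
      intro j _
      rw [abs_mul]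
      exact mul_le_mul (hz1 j) (hDj j) (abs_nonneg _) (by positivity)
    simpa using Finset.sum_le_sum this
  have b3 : m * (X * ((S : ℝ) ^ (n * t))⁻¹) ≤ γ / 2 := by
    rw [← mul_assoc, ← div_eq_mul_inv, div_le_iff₀ hSp]; linarith
  have b4 : γ / 2 ≤ n * (((S : ℝ) ^ m) ^ t * D) := by
    have := abs_sub (∑ i, (x i : ℝ) * ((∑ j, θ i j * (z j : ℝ)) - round (∑ j, θ i j * (z j : ℝ))))
      (∑ j, (z j : ℝ) * ((∑ i : Fin m, θ i j * (x i : ℝ)) - η j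
        - round ((∑ i : Fin m, θ i j * (x i : ℝ)) - η j)))
    linarith
  have hP : (0 : ℝ) < ((S : ℝ) ^ m) ^ t := by positivity
  have b5 : γ / (2 * n) / ((S : ℝ) ^ m) ^ t ≤ D := by
    rw [div_div, div_le_iff₀ (by positivity)]; linarith
  have b6 : (γ / (2 * n)) ^ n / ((S : ℝ) ^ (n * t)) ^ m ≤ D ^ n := by
    have := pow_le_pow_left₀ (by positivity) b5 n
    rw [div_pow] at this
    have e : (((S : ℝ) ^ m) ^ t) ^ n = ((S : ℝ) ^ (n * t)) ^ m := by
      rw [← pow_mul, ← pow_mul, ← pow_mul]; congr 1; ring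
    rwa [e] at this
  have b7 : ((S : ℝ) ^ (n * t)) ^ m ≤ A ^ m * X ^ m := by
    rw [← mul_pow]; exact pow_le_pow_left₀ hSp.le ht2 m
  have hXp : 0 < X ^ m := by positivity
  calc (γ / (2 * n)) ^ n / A ^ m = (γ / (2 * n)) ^ n / (A ^ m * X ^ m) * X ^ m := by
        field_simp
    _ ≤ (γ / (2 * n)) ^ n / ((S : ℝ) ^ (n * t)) ^ m * X ^ m := by gcongr
    _ ≤ D ^ n * X ^ m := by gcongr

lemma dim_bound (m n : ℕ) (hm : 0 < m) (hn : 0 < n) (θ : Fin m → Fin n → ℝ) (N u : ℕ)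
    (hu : 0 < u) (hN : N + 1 = m * u) (hN0 : 0 < N) :
    (n : ENNReal) * (((N : NNReal) / (N + 1) : NNReal) : ENNReal) ≤ dimH {η : Fin n → ℝ |
        0 < ⨅ x : {x : Fin m → ℤ // x ≠ 0},
            (⨆ j : Fin n, dnint ((∑ i : Fin m, θ i j * (x.val i : ℝ)) - η j)) ^ n *
              (⨆ i : Fin m, (|x.val i| : ℝ)) ^ m} := by
  have hn' : (0 : ℝ) < n := by exact_mod_cast hn
  set q : ℕ := 16 ^ N with hq
  set S : ℕ := 16 ^ u with hS
  have hq1 : 1 < q := Nat.one_lt_pow hN0.ne' (by norm_num)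
  have hS2 : 2 ≤ S := Nat.one_lt_pow hu.ne' (by norm_num)
  have hRS : 16 * q = S ^ m := by
    rw [hq, hS, ← pow_succ', hN, ← pow_mul, mul_comm]
  have hRSr : (16 : ℝ) * q = (S : ℝ) ^ m := by exact_mod_cast hRS
  set M : (Fin n → ℤ) → ℝ := fun y =>
    ‖(fun i => (∑ j, θ i j * (y j : ℝ)) - round (∑ j, θ i j * (y j : ℝ)) : Fin m → ℝ)‖ with hM
  obtain ⟨z, hz1, hz2, hz3⟩ := window_seq n (16 * q) hn (by omega) M
  have hz1' : ∀ k j, |(z k j : ℝ)| ≤ (16 * q : ℝ) ^ k := fun k j => by exact_mod_cast hz1 k j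
  set ρ : ℝ := 1 / (4 * n) with hρ
  have hρ0 : 0 < ρ := by positivity
  have hq0 : (0 : ℝ) < q := by positivity
  obtain ⟨x, hx1, hx2⟩ := cantor_exists n q hq1 ρ hρ0 z (by
    intro k j
    calc (n : ℝ) * |(z k j : ℝ)| * (ρ / (16 * q) ^ k)
        ≤ n * (16 * q : ℝ) ^ k * (ρ / (16 * q) ^ k) := by
          gcongr
          exact hz1' k j
      _ = 1 / 4 := by rw [hρ]; field_simp)
  set γ : ℝ := 3 / 16 * ρ / (16 * q) with hγ
  have hγ0 : 0 < γ := by positivity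
  have hgam : ∀ d k (p : ℤ), γ ≤ |(∑ j, (z k j : ℝ) * x d j) - p| := by
    intro d k p
    obtain ⟨j, hj⟩ := hz2 k
    have hj' : (16 * q : ℝ) ^ k < 16 * q * |(z k j : ℝ)| := by exact_mod_cast hj
    refine le_trans ?_ (hx1 d k p j)
    have hp : (0 : ℝ) < (16 * q) ^ k := by positivity
    have : 1 / (16 * q : ℝ) ≤ |(z k j : ℝ)| / (16 * q) ^ k := by
      rw [div_le_div_iff₀ (by positivity) hp]; linarith
    calc γ = 3 / 16 * ρ * (1 / (16 * q : ℝ)) := by rw [hγ]; ring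
      _ ≤ 3 / 16 * ρ * (|(z k j : ℝ)| / (16 * q) ^ k) := by gcongr
      _ = _ := by ring
  have hsub : Set.range x ⊆ {η : Fin n → ℝ |
        0 < ⨅ x : {x : Fin m → ℤ // x ≠ 0},
            (⨆ j : Fin n, dnint ((∑ i : Fin m, θ i j * (x.val i : ℝ)) - η j)) ^ n *
              (⨆ i : Fin m, (|x.val i| : ℝ)) ^ m} := by
    rintro _ ⟨d, rfl⟩
    refine transfer_s3 m n hm hn θ S hS2 γ hγ0 (x d) fun t => ?_
    obtain ⟨y, hy0, hy1, hy2⟩ := dirichlet_dual m n ((16 * q) ^ t) (S ^ (n * t)) (by positivity) (by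
      have : (S ^ (n * t)) ^ m = ((16 * q) ^ t) ^ n := by
        rw [hRS]; clear_value S; ring
      rw [this]
      exact Nat.pow_lt_pow_left (Nat.lt_succ_self _) hn.ne') θ
    obtain ⟨s, hst, hs⟩ := hz3 t y hy0 (fun j => by exact_mod_cast hy1 j)
    refine ⟨z s, fun j => ?_, fun i => ?_, hgam d s⟩
    · rw [← hRSr]
      refine (hz1' s j).trans (pow_le_pow_right₀ ?_ hst)
      have : (1 : ℝ) ≤ q := by exact_mod_cast hq1.le
      linarith
    · have h1 : M y ≤ ((S : ℝ) ^ (n * t))⁻¹ := by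
        rw [hM]
        refine (pi_norm_le_iff_of_nonneg (by positivity)).2 fun i => ?_
        have := hy2 i
        push_cast at this
        exact this
      exact (norm_le_pi_norm (fun i => (∑ j, θ i j * (z s j : ℝ)) -
        round (∑ j, θ i j * (z s j : ℝ)) : Fin m → ℝ) i).trans (hs.trans h1)
  refine le_trans ?_ (dimH_mono hsub)
  set α : NNReal := (N : NNReal) / (N + 1) with hα
  have hα0 : 0 < α := by
    have : (0 : NNReal) < N := by exact_mod_cast hN0
    positivity
  have hRα : (16 * q : ℝ) ^ (α : ℝ) = q := by
    have e : (16 * q : ℝ) = (16 : ℝ) ^ ((N : ℝ) + 1) := by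
      rw [hq, Real.rpow_add (by norm_num), Real.rpow_natCast]; push_cast; rw [Real.rpow_one]; ring
    have e2 : ((N : ℝ) + 1) * (α : ℝ) = N := by
      rw [hα]; push_cast; field_simp
    rw [e, ← Real.rpow_mul (by norm_num), e2, Real.rpow_natCast, hq]
    push_cast; rfl
  have hb0 : 0 < (ρ / (8 * q)) ^ (α : ℝ) := by positivity
  refine cantor_dim_s3 n q hq1 x ⟨((ρ / (8 * q)) ^ (α : ℝ))⁻¹, by positivity⟩ α hα0 ?_
  intro d e k h1 h2
  have h3 := Real.rpow_le_rpow (by positivity) (hx2 d e k h1 h2) (NNReal.coe_nonneg α)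
  have h4 : (ρ / (16 * q) ^ k / (8 * q)) ^ (α : ℝ) = (ρ / (8 * q)) ^ (α : ℝ) * ((q : ℝ) ^ k)⁻¹ := by
    have : ρ / (16 * q) ^ k / (8 * q) = (ρ / (8 * q)) * ((16 * q : ℝ) ^ k)⁻¹ := by
      field_simp
    rw [this, Real.mul_rpow (by positivity) (by positivity), Real.inv_rpow (by positivity),
      ← Real.rpow_natCast (16 * q : ℝ) k, ← Real.rpow_mul (by positivity), mul_comm (k : ℝ),
      Real.rpow_mul (by positivity), hRα, Real.rpow_natCast]
  rw [h4] at h3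
  change _ ≤ ((ρ / (8 * q)) ^ (α : ℝ))⁻¹ * _
  rw [inv_mul_eq_div, le_div_iff₀ hb0]
  linarith

/-- For any `Θ`, the set of `η ∈ ℝ^n` badly approximable with respect to the
inhomogeneous forms `L_j(x) - η_j` has full Hausdorff dimension `n`. -/
theorem bad_set_full_dimension (m n : ℕ) (hm : 0 < m) (hn : 0 < n)
    (θ : Fin m → Fin n → ℝ) :
    dimH {η : Fin n → ℝ |
        0 < ⨅ x : {x : Fin m → ℤ // x ≠ 0},
            (⨆ j : Fin n, dnint ((∑ i : Fin m, θ i j * (x.val i : ℝ)) - η j)) ^ n *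
              (⨆ i : Fin m, (|x.val i| : ℝ)) ^ m} = (n : ℕ) := by
  apply le_antisymm
  · refine (dimH_mono (Set.subset_univ _)).trans ?_
    rw [Real.dimH_univ_pi_fin]
  · have hb := dim_bound m n hm hn θ
    set T := {η : Fin n → ℝ |
        0 < ⨅ x : {x : Fin m → ℤ // x ≠ 0},
            (⨆ j : Fin n, dnint ((∑ i : Fin m, θ i j * (x.val i : ℝ)) - η j)) ^ n *
              (⨆ i : Fin m, (|x.val i| : ℝ)) ^ m}
    have hT : dimH T ≠ ⊤ := Real.dimH_ne_top T
    obtain ⟨D, hD⟩ : ∃ D : NNReal, dimH T = D := ⟨_, (ENNReal.coe_toNNReal hT).symm⟩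
    rw [hD] at hb ⊢
    have hb' : ∀ u : ℕ, (n : ℝ) ≤ D + n / ((u : ℝ) + 2) := by
      intro u
      have hge : u + 2 ≤ m * (u + 2) := Nat.le_mul_of_pos_left _ hm
      have h := hb (m * (u + 2) - 1) (u + 2) (by omega) (by omega) (by omega)
      obtain ⟨N, hN⟩ : ∃ N, N = m * (u + 2) - 1 := ⟨_, rfl⟩
      rw [← hN] at h
      have h' : (n : ℝ) * (N / (N + 1)) ≤ D := by exact_mod_cast h
      have hNu : (u : ℝ) + 2 ≤ N + 1 := by
        have : u + 2 ≤ N + 1 := by omega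
        exact_mod_cast this
      have e : (n : ℝ) = n * (N / (N + 1)) + n / (N + 1) := by field_simp
      have : (n : ℝ) / (N + 1) ≤ n / ((u : ℝ) + 2) := by gcongr
      linarith
    have hlim : (n : ℝ) ≤ D := by
      refine le_of_forall_pos_lt_add fun ε hε => ?_
      obtain ⟨u, hu⟩ := exists_nat_gt ((n : ℝ) / ε)
      have h1 := hb' u
      have : (n : ℝ) / ((u : ℝ) + 2) < ε := by
        rw [div_lt_iff₀ hε] at hu
        rw [div_lt_iff₀ (by positivity)]
        nlinarith
      linarith
    exact_mod_cast hlim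
end

section
/- Let m, n be positive integers. For any countable family Θ^{(1)}, Θ^{(2)}, Θ^{(3)}, … of m×n real matrices, the intersection ∩_{k≥1} 𝓑(Θ^{(k)}) has full Hausdorff dimension in ℝ^n, i.e. its Hausdorff dimension equals n. In particular this intersection is nonempty. -/
open scoped ENNReal NNReal
/-- Closed cube of level `q` in base `b` with integer corner `v`. -/
def bcube (n b q : ℕ) (v : Fin n → ℤ) : Set (Fin n → ℝ) :=
  Set.Icc (fun j => (v j : ℝ) / (b : ℝ) ^ q) (fun j => ((v j : ℝ) + 1) / (b : ℝ) ^ q)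

/-- corner of a child -/
def bchild {n b : ℕ} (v : Fin n → ℤ) (d : Fin n → Fin b) : Fin n → ℤ :=
  fun j => (b : ℤ) * v j + ((d j : ℕ) : ℤ)

lemma mem_bcube {n b q : ℕ} (hb : 0 < b) {v : Fin n → ℤ} {η : Fin n → ℝ} :
    η ∈ bcube n b q v ↔ ∀ j, (v j : ℝ) ≤ (b : ℝ) ^ q * η j ∧ (b : ℝ) ^ q * η j ≤ v j + 1 := by
  have h : (0 : ℝ) < (b : ℝ) ^ q := by positivity
  simp only [bcube, Set.mem_Icc, Pi.le_def, div_le_iff₀ h, le_div_iff₀ h, ← forall_and]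
  simp only [mul_comm]

lemma bchild_subset {n b q : ℕ} (hb : 0 < b) (v : Fin n → ℤ) (d : Fin n → Fin b) :
    bcube n b (q + 1) (bchild v d) ⊆ bcube n b q v := by
  intro η h
  rw [mem_bcube hb] at h ⊢
  intro j
  obtain ⟨h1, h2⟩ := h j
  have hd : ((d j : ℕ) : ℝ) + 1 ≤ b := by exact_mod_cast (d j).2
  have hd0 : (0 : ℝ) ≤ ((d j : ℕ) : ℝ) := by positivity
  have hb' : (0 : ℝ) < b := by exact_mod_cast hb
  simp only [bchild] at h1 h2
  push_cast at h1 h2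
  rw [pow_succ'] at h1 h2
  constructor
  · refine le_of_mul_le_mul_left ?_ hb'
    linarith
  · refine le_of_mul_le_mul_left ?_ hb'
    linarith

open Classical in
lemma avoid {n b : ℕ} (hb : 0 < b) {ι : Type*} (A : ι → Set (Fin n → ℝ)) (p f : ι → ℕ)
    (μ : ι → ℝ≥0) (hpf : ∀ i, p i ≤ f i)
    (hcount : ∀ i q v, p i ≤ q → q < f i →
      2 * ((Finset.univ.filter (fun d : Fin n → Fin b =>
        (A i ∩ bcube n b (q + 1) (bchild v d)).Nonempty)).card : ℝ≥0) ≤ μ i * (b : ℝ≥0) ^ n)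
    (hnew : ∀ q, ∑' i, (if p i = q then ((μ i : ℝ≥0∞)) ^ (f i - q) else 0) ≤ 4⁻¹) :
    ∃ η : Fin n → ℝ, ∀ i, η ∉ A i := by
  let w : ℕ → (Fin n → ℤ) → ι → ℝ≥0∞ := fun q v i =>
    if p i ≤ q ∧ q ≤ f i ∧ (A i ∩ bcube n b q v).Nonempty then (μ i : ℝ≥0∞) ^ (f i - q) else 0
  let φ : ℕ → (Fin n → ℤ) → ℝ≥0∞ := fun q v => ∑' i, w q v i
  let o : ℕ → (Fin n → ℤ) → ι → ℝ≥0∞ := fun q v i =>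
    if p i ≤ q ∧ q + 1 ≤ f i ∧ (A i ∩ bcube n b (q + 1) v).Nonempty then
      (μ i : ℝ≥0∞) ^ (f i - (q + 1)) else 0
  have h42 : (4⁻¹ : ℝ≥0∞) + 4⁻¹ = 2⁻¹ := by
    rw [← two_mul, show (4 : ℝ≥0∞) = 2 * 2 by norm_num, ENNReal.mul_inv (by simp) (by simp),
      ← mul_assoc, ENNReal.mul_inv_cancel (by simp) (by simp), one_mul]
  have h22 : (2⁻¹ : ℝ≥0∞) * 2⁻¹ = 4⁻¹ := by
    rw [← ENNReal.mul_inv (by simp) (by simp)]; norm_num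
  have hbn : ((b : ℝ≥0∞) ^ n) ≠ 0 := by positivity
  have hbt : ((b : ℝ≥0∞) ^ n) ≠ ∞ := by simp
  have hstep : ∀ q v, φ q v ≤ 2⁻¹ → ∃ d : Fin n → Fin b, φ (q + 1) (bchild v d) ≤ 2⁻¹ := by
    intro q v hφ
    -- averaging
    have havg : ∑ d : Fin n → Fin b, ∑' i, o q (bchild v d) i ≤ (b : ℝ≥0∞) ^ n * (2⁻¹ * φ q v) := by
      rw [← Summable.tsum_finsetSum (fun _ _ => ENNReal.summable), ← ENNReal.tsum_mul_left, ← ENNReal.tsum_mul_left]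
      refine ENNReal.tsum_le_tsum fun i => ?_
      by_cases hi : p i ≤ q ∧ q + 1 ≤ f i
      · by_cases hne : (A i ∩ bcube n b q v).Nonempty
        · have e1 : ∀ d : Fin n → Fin b, o q (bchild v d) i =
              if (A i ∩ bcube n b (q + 1) (bchild v d)).Nonempty then
                (μ i : ℝ≥0∞) ^ (f i - (q + 1)) else 0 := by
            intro d; simp only [o, hi, true_and]
          simp only [e1]
          rw [← Finset.sum_filter, Finset.sum_const, nsmul_eq_mul]
          have e2 : w q v i = (μ i : ℝ≥0∞) ^ (f i - (q + 1)) * μ i := by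
            simp only [w, hi.1, (Nat.le_of_succ_le hi.2), hne, true_and, if_true]
            rw [← pow_succ]; congr 1; omega
          rw [e2]
          have h3 := hcount i q v hi.1 hi.2
          have h4 : 2 * ((Finset.univ.filter (fun d : Fin n → Fin b =>
            (A i ∩ bcube n b (q + 1) (bchild v d)).Nonempty)).card : ℝ≥0∞) ≤ μ i * (b : ℝ≥0∞) ^ n := by
            exact_mod_cast h3
          set c := ((Finset.univ.filter (fun d : Fin n → Fin b =>
            (A i ∩ bcube n b (q + 1) (bchild v d)).Nonempty)).card : ℝ≥0∞)
          calc c * (μ i : ℝ≥0∞) ^ (f i - (q + 1))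
              = 2⁻¹ * (2 * c) * (μ i : ℝ≥0∞) ^ (f i - (q + 1)) := by
                rw [← mul_assoc 2⁻¹, ENNReal.inv_mul_cancel (by simp) (by simp), one_mul]
            _ ≤ 2⁻¹ * (μ i * (b : ℝ≥0∞) ^ n) * (μ i : ℝ≥0∞) ^ (f i - (q + 1)) := by gcongr
            _ = _ := by ring
        · have : ∀ d : Fin n → Fin b, o q (bchild v d) i = 0 := by
            intro d
            simp only [o]
            rw [if_neg]
            rintro ⟨_, _, x, hx1, hx2⟩
            exact hne ⟨x, hx1, bchild_subset hb v d hx2⟩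
          simp [this]
      · have : ∀ d : Fin n → Fin b, o q (bchild v d) i = 0 := by
          intro d
          simp only [o]
          rw [if_neg]
          rintro ⟨h1, h2, _⟩
          exact hi ⟨h1, h2⟩
        simp [this]
    have hex : ∃ d : Fin n → Fin b, ∑' i, o q (bchild v d) i ≤ 2⁻¹ * φ q v := by
      have hne : (Finset.univ : Finset (Fin n → Fin b)).Nonempty :=
        ⟨fun _ => ⟨0, hb⟩, Finset.mem_univ _⟩
      obtain ⟨d, -, hd⟩ := Finset.exists_min_image Finset.univ
        (fun d : Fin n → Fin b => ∑' i, o q (bchild v d) i) hne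
      refine ⟨d, ?_⟩
      have h5 := (Finset.card_nsmul_le_sum Finset.univ
        (fun d : Fin n → Fin b => ∑' i, o q (bchild v d) i) _ hd).trans havg
      simp only [Finset.card_univ, Fintype.card_fun, Fintype.card_fin, nsmul_eq_mul,
        Nat.cast_pow] at h5
      exact (ENNReal.mul_le_mul_iff_right hbn hbt).1 h5
    obtain ⟨d, hd⟩ := hex
    refine ⟨d, ?_⟩
    calc φ (q + 1) (bchild v d) ≤ ∑' i, (o q (bchild v d) i +
          (if p i = q + 1 then ((μ i : ℝ≥0∞)) ^ (f i - (q + 1)) else 0)) := by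
          refine ENNReal.tsum_le_tsum fun i => ?_
          simp only [w, o]
          split_ifs with h1 h2 h3 h3 h3 <;> simp
          exact absurd (show p i = q + 1 by have := h1.1; have : ¬ p i ≤ q := fun h => h2 ⟨h, h1.2⟩; omega) h3
      _ = ∑' i, o q (bchild v d) i + _ := ENNReal.tsum_add
      _ ≤ 2⁻¹ * 2⁻¹ + 4⁻¹ := by
          refine add_le_add (hd.trans ?_) (hnew (q + 1))
          gcongr
      _ = 2⁻¹ := by rw [h22, h42]
  have hstart : φ 0 (fun _ => 0) ≤ 2⁻¹ := by
    calc φ 0 (fun _ => 0) ≤ 4⁻¹ := by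
          refine le_trans (ENNReal.tsum_le_tsum fun i => ?_) (hnew 0)
          simp only [w]
          split_ifs with h1 h2 h3 <;> simp
          exact absurd (show p i = 0 by have := h1.1; omega) h2
      _ ≤ 2⁻¹ := by rw [← h42]; exact le_self_add
  have : Nonempty (Fin n → Fin b) := ⟨fun _ => ⟨0, hb⟩⟩
  choose! D hD using hstep
  let V : ℕ → (Fin n → ℤ) := fun q => Nat.rec (fun _ => 0) (fun q v => bchild v (D q v)) q
  have hV : ∀ q, φ q (V q) ≤ 2⁻¹ := by
    intro q
    induction q with
    | zero => exact hstart
    | succ q ih => exact hD q (V q) ih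
  have hne : ∀ q v, (bcube n b q v).Nonempty := by
    intro q v
    refine Set.nonempty_Icc.2 fun j => ?_
    have h : (0 : ℝ) < (b : ℝ) ^ q := by positivity
    beta_reduce
    gcongr
    linarith
  obtain ⟨η, hη⟩ := IsCompact.nonempty_iInter_of_sequence_nonempty_isCompact_isClosed
    (fun q => bcube n b q (V q)) (fun q => bchild_subset hb _ _) (fun q => hne _ _)
    isCompact_Icc (fun q => isClosed_Icc)
  refine ⟨η, fun i hi => ?_⟩
  have h1 : (1 : ℝ≥0∞) ≤ φ (f i) (V (f i)) := by
    refine le_trans ?_ (ENNReal.le_tsum i)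
    simp only [w]
    rw [if_pos ⟨hpf i, le_rfl, η, hi, Set.mem_iInter.1 hη _⟩]
    simp
  have h2 := h1.trans (hV (f i))
  rw [ENNReal.one_le_inv] at h2
  norm_num at h2
lemma card_near {b : ℕ} (c : ℕ) (e : Fin b) (F : Finset (Fin b))
    (h : ∀ x ∈ F, |((x : ℕ) : ℝ) - ((e : ℕ) : ℝ)| ≤ c) : F.card ≤ 2 * c + 1 := by
  have h1 : F.card ≤ (Finset.Icc ((e : ℕ) - (c : ℤ)) ((e : ℕ) + (c : ℤ))).card := by
    refine Finset.card_le_card_of_injOn (fun x => ((x : ℕ) : ℤ)) ?_ ?_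
    · intro x hx
      have h2 := abs_le.1 (h x hx)
      have h3 : ((e : ℕ) : ℤ) - c ≤ ((x : ℕ) : ℤ) := by
        have : ((e : ℕ) : ℝ) - c ≤ ((x : ℕ) : ℝ) := by linarith
        exact_mod_cast this
      have h4 : ((x : ℕ) : ℤ) ≤ ((e : ℕ) : ℤ) + c := by
        have : ((x : ℕ) : ℝ) ≤ ((e : ℕ) : ℝ) + c := by linarith
        exact_mod_cast this
      simp only [Finset.coe_Icc, Set.mem_Icc]
      exact ⟨h3, h4⟩
    · intro x _ y _ hxy
      simp only at hxy
      exact Fin.ext (by exact_mod_cast hxy)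
  rw [Int.card_Icc] at h1
  omega

open Classical in
lemma count_small {n b q : ℕ} (hb : 0 < b) (U : Set (Fin n → ℝ)) (v : Fin n → ℤ)
    (hU : ∀ x ∈ U, ∀ y ∈ U, ∀ j, (b : ℝ) ^ (q + 1) * |x j - y j| ≤ 1) :
    (Finset.univ.filter (fun d : Fin n → Fin b =>
        (U ∩ bcube n b (q + 1) (bchild v d)).Nonempty)).card ≤ 5 ^ n := by
  set F := Finset.univ.filter (fun d : Fin n → Fin b =>
        (U ∩ bcube n b (q + 1) (bchild v d)).Nonempty) with hF
  rcases F.eq_empty_or_nonempty with h | ⟨d0, hd0⟩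
  · rw [h]; simp
  have hsub : F ⊆ Fintype.piFinset (fun j => Finset.univ.filter (fun x : Fin b =>
      |((x : ℕ) : ℝ) - ((d0 j : ℕ) : ℝ)| ≤ (2 : ℕ))) := by
    intro d hd
    simp only [Fintype.mem_piFinset, Finset.mem_filter, Finset.mem_univ, true_and]
    intro j
    obtain ⟨x, hxU, hx⟩ := (Finset.mem_filter.1 hd).2
    obtain ⟨y, hyU, hy⟩ := (Finset.mem_filter.1 hd0).2
    have h1 := (mem_bcube hb).1 hx j
    have h2 := (mem_bcube hb).1 hy j
    have h3 := hU x hxU y hyU j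
    have hp : (0 : ℝ) < (b : ℝ) ^ (q + 1) := by positivity
    rw [← abs_of_pos hp, ← abs_mul, mul_sub, abs_le] at h3
    simp only [bchild] at h1 h2
    push_cast at h1 h2 ⊢
    rw [abs_le]
    constructor <;> linarith
  refine (Finset.card_le_card hsub).trans ?_
  rw [Fintype.card_piFinset]
  calc _ ≤ ∏ j : Fin n, 5 := by
        refine Finset.prod_le_prod' fun j _ => ?_
        exact card_near 2 (d0 j) _ (fun x hx => (Finset.mem_filter.1 hx).2)
    _ = 5 ^ n := by simp

/-- sup norm of an integer vector, as a natural number -/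
def hgt {n : ℕ} (y : Fin n → ℤ) : ℕ := Finset.univ.sup (fun j => (y j).natAbs)

lemma natAbs_le_hgt {n : ℕ} (y : Fin n → ℤ) (j : Fin n) : (y j).natAbs ≤ hgt y :=
  Finset.le_sup (f := fun j => (y j).natAbs) (Finset.mem_univ j)

lemma abs_le_hgt {n : ℕ} (y : Fin n → ℤ) (j : Fin n) : |(y j : ℝ)| ≤ hgt y := by
  have h := natAbs_le_hgt y j
  rw [← Int.cast_abs, Int.abs_eq_natAbs]
  exact_mod_cast h

lemma hgt_pos {n : ℕ} {y : Fin n → ℤ} (hy : y ≠ 0) : 0 < hgt y := by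
  obtain ⟨j, hj⟩ := Function.ne_iff.1 hy
  have := natAbs_le_hgt y j
  have : 0 < (y j).natAbs := Int.natAbs_pos.2 hj
  omega

/-- neighbourhood of the hyperplanes `y·η ∈ ℤ` -/
def slab {n : ℕ} (y : Fin n → ℤ) (γ : ℝ) : Set (Fin n → ℝ) :=
  {η | ∃ a : ℤ, |∑ j, (y j : ℝ) * η j - a| < γ}

lemma slab_fiber {n b q : ℕ} (hb : 0 < b) {y : Fin n → ℤ} {γ : ℝ} (hγ : γ ≤ 1 / 8)
    (hq : 4 * n * hgt y ≤ b ^ q) (hγ2 : γ * (b : ℝ) ^ (q + 1) ≤ hgt y) (hy : y ≠ 0)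
    (j₀ : Fin n) (hj₀ : (y j₀).natAbs = hgt y) {v : Fin n → ℤ} {d d' : Fin n → Fin b}
    (hd : (slab y γ ∩ bcube n b (q + 1) (bchild v d)).Nonempty)
    (hd' : (slab y γ ∩ bcube n b (q + 1) (bchild v d')).Nonempty)
    (hdd : ∀ j, j ≠ j₀ → d j = d' j) :
    |((d j₀ : ℕ) : ℝ) - ((d' j₀ : ℕ) : ℝ)| ≤ (n + 2 : ℕ) := by
  obtain ⟨x, ⟨a, ha⟩, hx⟩ := hd
  obtain ⟨x', ⟨a', ha'⟩, hx'⟩ := hd'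
  have hX := (mem_bcube hb).1 (bchild_subset hb v d hx)
  have hX' := (mem_bcube hb).1 (bchild_subset hb v d' hx')
  have hx := (mem_bcube hb).1 hx
  have hx' := (mem_bcube hb).1 hx'
  have hR : (0 : ℝ) < hgt y := by exact_mod_cast hgt_pos hy
  have hbq : (0 : ℝ) < (b : ℝ) ^ q := by positivity
  have hbq1 : (0 : ℝ) < (b : ℝ) ^ (q + 1) := by positivity
  have hqr : 4 * (n : ℝ) * hgt y ≤ (b : ℝ) ^ q := by exact_mod_cast hq
  have hdiff : ∑ j, (y j : ℝ) * x j - ∑ j, (y j : ℝ) * x' j = ∑ j, (y j : ℝ) * (x j - x' j) := by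
    rw [← Finset.sum_sub_distrib]; simp only [mul_sub]
  have hvar : (b : ℝ) ^ q * |∑ j, (y j : ℝ) * (x j - x' j)| ≤ n * hgt y := by
    rw [← abs_of_pos hbq, ← abs_mul, Finset.mul_sum]
    refine (Finset.abs_sum_le_sum_abs _ _).trans ?_
    calc _ ≤ ∑ j : Fin n, (hgt y : ℝ) := by
          refine Finset.sum_le_sum fun j _ => ?_
          rw [mul_left_comm, abs_mul]
          have : |(b : ℝ) ^ q * (x j - x' j)| ≤ 1 := by
            rw [mul_sub, abs_le]
            have := hX j; have := hX' j
            constructor <;> linarith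
          calc _ ≤ (hgt y : ℝ) * 1 := mul_le_mul (abs_le_hgt y j) this (abs_nonneg _) hR.le
            _ = _ := mul_one _
      _ = _ := by simp
  have haa : a = a' := by
    have h1 : |∑ j, (y j : ℝ) * (x j - x' j)| ≤ 1 / 4 := by
      have : (b : ℝ) ^ q * |∑ j, (y j : ℝ) * (x j - x' j)| ≤ (b : ℝ) ^ q * (1 / 4) := by linarith
      exact le_of_mul_le_mul_left this hbq
    rw [← hdiff] at h1
    rw [abs_lt] at ha ha'
    rw [abs_le] at h1
    have h2 : ((a - a' : ℤ) : ℝ) < 1 := by push_cast; linarith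
    have h3 : (-1 : ℝ) < ((a - a' : ℤ) : ℝ) := by push_cast; linarith
    have h2' : a - a' < 1 := by exact_mod_cast h2
    have h3' : -1 < a - a' := by exact_mod_cast h3
    omega
  subst haa
  have h1 : (b : ℝ) ^ (q + 1) * |∑ j, (y j : ℝ) * (x j - x' j)| ≤ 2 * hgt y := by
    have : |∑ j, (y j : ℝ) * (x j - x' j)| ≤ 2 * γ := by
      rw [← hdiff]
      rw [abs_lt] at ha ha'
      rw [abs_le]
      constructor <;> linarith
    calc _ ≤ (b : ℝ) ^ (q + 1) * (2 * γ) := by gcongr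
      _ ≤ _ := by linarith
  set D : ℝ := ((d j₀ : ℕ) : ℝ) - ((d' j₀ : ℕ) : ℝ) with hD
  have h2 : |(y j₀ : ℝ) * D - (b : ℝ) ^ (q + 1) * ∑ j, (y j : ℝ) * (x j - x' j)| ≤ n * hgt y := by
    have e : (y j₀ : ℝ) * D = ∑ j, (y j : ℝ) * (((d j : ℕ) : ℝ) - ((d' j : ℕ) : ℝ)) := by
      rw [Finset.sum_eq_single j₀]
      · intro j _ hj
        rw [hdd j hj]; simp
      · simp
    rw [e, Finset.mul_sum, ← Finset.sum_sub_distrib]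
    refine (Finset.abs_sum_le_sum_abs _ _).trans ?_
    calc _ ≤ ∑ j : Fin n, (hgt y : ℝ) := by
          refine Finset.sum_le_sum fun j _ => ?_
          rw [mul_left_comm, ← mul_sub, abs_mul]
          have : |((d j : ℕ) : ℝ) - ((d' j : ℕ) : ℝ) - (b : ℝ) ^ (q + 1) * (x j - x' j)| ≤ 1 := by
            have h3 := hx j; have h4 := hx' j
            simp only [bchild] at h3 h4
            push_cast at h3 h4
            rw [mul_sub, abs_le]
            constructor <;> linarith
          calc _ ≤ (hgt y : ℝ) * 1 := mul_le_mul (abs_le_hgt y j) this (abs_nonneg _) hR.le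
            _ = _ := mul_one _
      _ = _ := by simp
  have h3 : |(y j₀ : ℝ) * D| ≤ (n + 2) * hgt y := by
    rw [← abs_of_pos hbq1, ← abs_mul] at h1
    have := abs_le.1 h1
    have := abs_le.1 h2
    rw [abs_le]
    constructor <;> linarith
  have h4 : |(y j₀ : ℝ)| = hgt y := by
    rw [← Int.cast_abs, Int.abs_eq_natAbs, hj₀]; simp
  rw [abs_mul, h4, mul_comm] at h3
  push_cast
  exact le_of_mul_le_mul_right h3 hR

open Classical in
lemma count_slab {N b q : ℕ} (hb : 0 < b) {y : Fin (N + 1) → ℤ} {γ : ℝ} (hγ : γ ≤ 1 / 8)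
    (hq : 4 * (N + 1) * hgt y ≤ b ^ q) (hγ2 : γ * (b : ℝ) ^ (q + 1) ≤ hgt y) (hy : y ≠ 0)
    (v : Fin (N + 1) → ℤ) :
    (Finset.univ.filter (fun d : Fin (N + 1) → Fin b =>
      (slab y γ ∩ bcube (N + 1) b (q + 1) (bchild v d)).Nonempty)).card
      ≤ (2 * (N + 3) + 1) * b ^ N := by
  obtain ⟨j₀, -, hj₀⟩ := Finset.exists_mem_eq_sup (Finset.univ : Finset (Fin (N + 1)))
    Finset.univ_nonempty (fun j => (y j).natAbs)
  have hj₀ : (y j₀).natAbs = hgt y := hj₀.symm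
  set F := Finset.univ.filter (fun d : Fin (N + 1) → Fin b =>
      (slab y γ ∩ bcube (N + 1) b (q + 1) (bchild v d)).Nonempty) with hF
  have h1 : F.card ≤ (2 * (N + 3) + 1) * (F.image (fun d => Fin.removeNth j₀ d)).card := by
    refine Finset.card_le_mul_card_image F _ ?_
    intro u hu
    obtain ⟨d0, hd0, rfl⟩ := Finset.mem_image.1 hu
    set G := F.filter (fun d => Fin.removeNth j₀ d = Fin.removeNth j₀ d0)
    have hG : ∀ d ∈ G, ∀ j, j ≠ j₀ → d j = d0 j := by
      intro d hd j hj
      obtain ⟨i, rfl⟩ := Fin.exists_succAbove_eq hj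
      exact congrFun (Finset.mem_filter.1 hd).2 i
    have h2 : G.card = (G.image (fun d => d j₀)).card := by
      rw [Finset.card_image_of_injOn]
      intro d hd d' hd' h
      funext j
      by_cases hj : j = j₀
      · rw [hj]; exact h
      · rw [hG d hd j hj, hG d' hd' j hj]
    rw [h2]
    refine card_near (N + 3) (d0 j₀) _ ?_
    intro x hx
    obtain ⟨d, hd, rfl⟩ := Finset.mem_image.1 hx
    have hdF := (Finset.mem_filter.1 hd).1
    exact slab_fiber hb hγ hq hγ2 hy j₀ hj₀ (Finset.mem_filter.1 hdF).2
      (Finset.mem_filter.1 hd0).2 (hG d hd)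
  refine h1.trans (Nat.mul_le_mul_left _ ?_)
  refine (Finset.card_le_univ _).trans ?_
  simp

/-- all the dual forms are within `ε` of integers -/
def dsmall {m n : ℕ} (θ : Fin m → Fin n → ℝ) (ε : ℝ) (y : Fin n → ℤ) : Prop :=
  ∀ i, ∃ c : ℤ, |∑ j, θ i j * (y j : ℝ) - c| ≤ ε

lemma dirichlet_dual_s5 {m n : ℕ} (θ : Fin m → Fin n → ℝ) (Q N : ℕ) (hN : 0 < N)
    (h : N ^ m < (Q + 1) ^ n) : ∃ y : Fin n → ℤ, y ≠ 0 ∧ hgt y ≤ Q ∧ dsmall θ (1 / N) y := by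
  have hNr : (0 : ℝ) < N := by exact_mod_cast hN
  let g : (Fin n → Fin (Q + 1)) → (Fin m → Fin N) := fun z i =>
    ⟨⌊(N : ℝ) * Int.fract (∑ j, θ i j * ((z j : ℕ) : ℝ))⌋₊, by
      rw [Nat.floor_lt (by have := Int.fract_nonneg (∑ j, θ i j * ((z j : ℕ) : ℝ)); positivity)]
      have := Int.fract_lt_one (∑ j, θ i j * ((z j : ℕ) : ℝ))
      nlinarith⟩
  obtain ⟨z, z', hne, hzz⟩ := Fintype.exists_ne_map_eq_of_card_lt g (by simpa using h)
  refine ⟨fun j => ((z j : ℕ) : ℤ) - ((z' j : ℕ) : ℤ), ?_, ?_, ?_⟩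
  · intro h0
    apply hne
    funext j
    have := congrFun h0 j
    simp only [Pi.zero_apply] at this
    exact Fin.ext (by omega)
  · refine Finset.sup_le fun j _ => ?_
    have := (z j).2; have := (z' j).2
    beta_reduce
    omega
  · intro i
    refine ⟨⌊∑ j, θ i j * ((z j : ℕ) : ℝ)⌋ - ⌊∑ j, θ i j * ((z' j : ℕ) : ℝ)⌋, ?_⟩
    have h1 : ⌊(N : ℝ) * Int.fract (∑ j, θ i j * ((z j : ℕ) : ℝ))⌋₊ =
        ⌊(N : ℝ) * Int.fract (∑ j, θ i j * ((z' j : ℕ) : ℝ))⌋₊ := by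
      have := congrFun hzz i
      exact congrArg Fin.val this
    have e : ∑ j, θ i j * (((((z j : ℕ) : ℤ) - ((z' j : ℕ) : ℤ) : ℤ)) : ℝ) =
        ∑ j, θ i j * ((z j : ℕ) : ℝ) - ∑ j, θ i j * ((z' j : ℕ) : ℝ) := by
      rw [← Finset.sum_sub_distrib]
      refine Finset.sum_congr rfl fun j _ => ?_
      push_cast; ring
    rw [e]
    set u := ∑ j, θ i j * ((z j : ℕ) : ℝ)
    set u' := ∑ j, θ i j * ((z' j : ℕ) : ℝ)
    have hu : 0 ≤ (N : ℝ) * Int.fract u := by have := Int.fract_nonneg u; positivity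
    have hu' : 0 ≤ (N : ℝ) * Int.fract u' := by have := Int.fract_nonneg u'; positivity
    have a1 := Nat.floor_le hu
    have a2 := Nat.lt_floor_add_one ((N : ℝ) * Int.fract u)
    have a3 := Nat.floor_le hu'
    have a4 := Nat.lt_floor_add_one ((N : ℝ) * Int.fract u')
    rw [h1] at a1 a2
    have e2 : u - u' - ((⌊u⌋ - ⌊u'⌋ : ℤ) : ℝ) = Int.fract u - Int.fract u' := by
      simp only [Int.fract]; push_cast; ring
    rw [e2, le_div_iff₀ hNr, mul_comm, ← abs_of_pos hNr, ← abs_mul, mul_sub, abs_le]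
    constructor <;> linarith

lemma exists_dual_seq {m n : ℕ} (hn : 0 < n) (θ : Fin m → Fin n → ℝ) (b : ℕ) (hb : 2 ≤ b) :
    ∃ (Y : ℕ → Fin n → ℤ) (K : ℕ), (∀ t, Y t ≠ 0) ∧ (∀ t, hgt (Y t) ≤ b ^ (m * t)) ∧
      (∀ t, dsmall θ (1 / (b : ℝ) ^ (n * t)) (Y t)) ∧
      ∀ Z : Set (Fin n → ℤ), Z ⊆ Set.range Y → (∀ y ∈ Z, ∀ y' ∈ Z, hgt y' < b * hgt y) →
        ∃ F : Finset (Fin n → ℤ), Z ⊆ F ∧ F.card ≤ K := by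
  have hb0 : 0 < b := by omega
  have hdir : ∀ t : ℕ, ∃ y : Fin n → ℤ, (y ≠ 0 ∧ dsmall θ (1 / (b : ℝ) ^ (n * t)) y) ∧
      hgt y ≤ b ^ (m * t) := by
    intro t
    obtain ⟨y, h1, h2, h3⟩ := dirichlet_dual_s5 θ (b ^ (m * t)) (b ^ (n * t)) (by positivity) (by
      rw [← pow_mul, show n * t * m = m * t * n by ring, pow_mul]
      exact Nat.pow_lt_pow_left (Nat.lt_succ_self _) hn.ne')
    exact ⟨y, ⟨h1, by simpa using h3⟩, h2⟩
  have hmin : ∀ t : ℕ, ∃ y : Fin n → ℤ, (y ≠ 0 ∧ dsmall θ (1 / (b : ℝ) ^ (n * t)) y) ∧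
      ∀ z : Fin n → ℤ, z ≠ 0 → dsmall θ (1 / (b : ℝ) ^ (n * t)) z → hgt y ≤ hgt z := by
    intro t
    obtain ⟨y0, hy0, -⟩ := hdir t
    obtain ⟨y, hy, hyy⟩ := (measure (hgt (n := n))).wf.has_min
      {y | y ≠ 0 ∧ dsmall θ (1 / (b : ℝ) ^ (n * t)) y} ⟨y0, hy0⟩
    exact ⟨y, hy, fun z hz hz' => not_lt.1 (hyy z ⟨hz, hz'⟩)⟩
  choose Y hY hYmin using hmin
  refine ⟨Y, (Fintype.piFinset (fun _ : Fin n => Finset.Icc (-(b : ℤ)) b) ×ˢ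
      (Finset.univ : Finset (Fin m → Bool))).card, fun t => (hY t).1, fun t => ?_,
      fun t => (hY t).2, ?_⟩
  · obtain ⟨y, hy, h⟩ := hdir t
    exact (hYmin t y hy.1 hy.2).trans h
  intro Z hZ hZh
  classical
  rcases Z.eq_empty_or_nonempty with rfl | ⟨z0, hz0⟩
  · exact ⟨∅, by simp, by simp⟩
  have hex : ∃ t, Y t ∈ Z := by
    obtain ⟨t, rfl⟩ := hZ hz0
    exact ⟨t, hz0⟩
  set t1 := Nat.find hex with ht1
  have hY1 : Y t1 ∈ Z := Nat.find_spec hex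
  set R := hgt (Y t1) with hR
  have hRpos : 0 < R := hgt_pos (hY t1).1
  set ε : ℝ := 1 / (b : ℝ) ^ (n * t1) with hε
  have hsm : ∀ z ∈ Z, dsmall θ ε z := by
    intro z hz i
    obtain ⟨t, rfl⟩ := hZ hz
    have htt : t1 ≤ t := Nat.find_min' hex hz
    obtain ⟨c, hc⟩ := (hY t).2 i
    refine ⟨c, hc.trans ?_⟩
    rw [hε]
    have : (1 : ℝ) ≤ b := by exact_mod_cast hb0
    gcongr
  let g : (Fin n → ℤ) → (Fin n → ℤ) × (Fin m → Bool) := fun y =>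
    (fun j => y j / (R : ℤ),
     fun i => decide (0 ≤ ∑ j, θ i j * (y j : ℝ) - round (∑ j, θ i j * (y j : ℝ))))
  have hinj : Set.InjOn g Z := by
    intro y hy y' hy' hg
    by_contra hne
    have hg1 : ∀ j, y j / (R : ℤ) = y' j / (R : ℤ) := fun j => congrFun (congrArg Prod.fst hg) j
    have hg2 := fun i => congrFun (congrArg Prod.snd hg) i
    have hRz : (0 : ℤ) < R := by exact_mod_cast hRpos
    have hlt : hgt (y - y') < R := by
      refine (Finset.sup_lt_iff hRpos).2 fun j _ => ?_
      have e1 := Int.emod_add_mul_ediv (y j) R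
      have e2 := Int.emod_add_mul_ediv (y' j) R
      have e3 := Int.emod_nonneg (y j) hRz.ne'
      have e4 := Int.emod_nonneg (y' j) hRz.ne'
      have e5 := Int.emod_lt_of_pos (y j) hRz
      have e6 := Int.emod_lt_of_pos (y' j) hRz
      rw [hg1 j] at e1
      simp only [Pi.sub_apply]
      omega
    have hsmd : dsmall θ ε (y - y') := by
      intro i
      refine ⟨round (∑ j, θ i j * (y j : ℝ)) - round (∑ j, θ i j * (y' j : ℝ)), ?_⟩
      have e : ∑ j, θ i j * (((y - y') j : ℤ) : ℝ) =
          ∑ j, θ i j * (y j : ℝ) - ∑ j, θ i j * (y' j : ℝ) := by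
        rw [← Finset.sum_sub_distrib]
        refine Finset.sum_congr rfl fun j _ => ?_
        simp only [Pi.sub_apply]
        push_cast; ring
      obtain ⟨c, hc⟩ := hsm y hy i
      obtain ⟨c', hc'⟩ := hsm y' hy' i
      have h1 := abs_le.1 ((round_le _ c).trans hc)
      have h2 := abs_le.1 ((round_le _ c').trans hc')
      have h3 := hg2 i
      simp only [g, decide_eq_decide] at h3
      rw [e]
      push_cast
      set u := ∑ j, θ i j * (y j : ℝ)
      set u' := ∑ j, θ i j * (y' j : ℝ)
      rw [abs_le]
      by_cases h4 : 0 ≤ u - round u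
      · have h5 := h3.1 h4
        constructor <;> linarith
      · have h5 : ¬ (0 ≤ u' - round u') := fun h => h4 (h3.2 h)
        push Not at h4 h5
        constructor <;> linarith
    have := hYmin t1 (y - y') (sub_ne_zero.2 hne) hsmd
    omega
  have hmaps : Set.MapsTo g Z (Fintype.piFinset (fun _ : Fin n => Finset.Icc (-(b : ℤ)) b) ×ˢ
      (Finset.univ : Finset (Fin m → Bool)) : Finset _) := by
    intro y hy
    simp only [Finset.coe_product, Set.mem_prod, Finset.mem_coe, Fintype.mem_piFinset,
      Finset.mem_Icc, Finset.mem_univ, and_true, g]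
    intro j
    have h1 := hZh _ hY1 y hy
    have h2 := natAbs_le_hgt y j
    have h3 : (y j).natAbs < b * R := lt_of_le_of_lt h2 h1
    have h4 : |y j| < (b : ℤ) * R := by
      rw [Int.abs_eq_natAbs]; exact_mod_cast h3
    have hRz : (0 : ℤ) < R := by exact_mod_cast hRpos
    rw [abs_lt] at h4
    constructor
    · rw [Int.le_ediv_iff_mul_le hRz]; linarith [h4.1]
    · exact (Int.ediv_lt_of_lt_mul hRz h4.2).le
  have hfin : Z.Finite := Set.Finite.of_injOn hmaps hinj (Finset.finite_toSet _)
  refine ⟨hfin.toFinset, by simp, ?_⟩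
  refine Finset.card_le_card_of_injOn g (fun y hy => hmaps ?_) (fun y hy y' hy' => hinj ?_ ?_)
  · simpa using hy
  · simpa using hy
  · simpa using hy'
lemma exists_int_dnint (t : ℝ) : ∃ a : ℤ, |t - a| ≤ dnint t :=
  ⟨round t, le_ciInf fun k => round_le t k⟩

lemma transfer_s5 {m n : ℕ} (θ : Fin m → Fin n → ℝ) (η : Fin n → ℝ) (x : Fin m → ℤ) (y : Fin n → ℤ)
    {γ ε ψ X : ℝ} (hη : η ∉ slab y γ) (hy : dsmall θ ε y)
    (hψ : ∀ j, dnint ((∑ i : Fin m, θ i j * (x i : ℝ)) - η j) ≤ ψ)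
    (hX : ∀ i, |(x i : ℝ)| ≤ X) : γ ≤ n * (hgt y * ψ) + m * (X * ε) := by
  choose a ha using fun j => exists_int_dnint ((∑ i : Fin m, θ i j * (x i : ℝ)) - η j)
  choose c hc using hy
  simp only [slab, Set.mem_ofPred_eq, not_exists, not_lt] at hη
  refine (hη (∑ i, x i * c i - ∑ j, y j * a j)).trans ?_
  have e : ∑ j, (y j : ℝ) * η j - ((∑ i, x i * c i - ∑ j, y j * a j : ℤ) : ℝ) =
      ∑ i, (x i : ℝ) * (∑ j, θ i j * (y j : ℝ) - c i) -
      ∑ j, (y j : ℝ) * ((∑ i : Fin m, θ i j * (x i : ℝ)) - η j - a j) := by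
    push_cast
    simp only [mul_sub, Finset.sum_sub_distrib, Finset.mul_sum]
    rw [Finset.sum_comm]
    have : ∑ j : Fin n, ∑ i : Fin m, (x i : ℝ) * (θ i j * (y j : ℝ)) =
        ∑ j : Fin n, ∑ i : Fin m, (y j : ℝ) * (θ i j * (x i : ℝ)) :=
      Finset.sum_congr rfl fun j _ => Finset.sum_congr rfl fun i _ => by ring
    rw [this]; ring
  rw [e]
  refine (abs_sub _ _).trans ?_
  rw [add_comm]
  refine add_le_add ?_ ?_
  · refine (Finset.abs_sum_le_sum_abs _ _).trans ?_
    calc _ ≤ ∑ j : Fin n, (hgt y : ℝ) * ψ := by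
          refine Finset.sum_le_sum fun j _ => ?_
          rw [abs_mul]
          exact mul_le_mul (abs_le_hgt y j) ((ha j).trans (hψ j)) (abs_nonneg _) (by positivity)
      _ = _ := by simp
  · refine (Finset.abs_sum_le_sum_abs _ _).trans ?_
    calc _ ≤ ∑ i : Fin m, X * ε := by
          refine Finset.sum_le_sum fun i _ => ?_
          rw [abs_mul]
          exact mul_le_mul (hX i) (hc i) (abs_nonneg _) ((abs_nonneg _).trans (hX i))
      _ = _ := by simp

lemma bad_of_avoid {m n b : ℕ} (hm : 0 < m) (hn : 0 < n) (hb : 2 ≤ b) (θ : Fin m → Fin n → ℝ)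
    (Y : ℕ → Fin n → ℤ) (hY : ∀ t, hgt (Y t) ≤ b ^ (m * t))
    (hYs : ∀ t, dsmall θ (1 / (b : ℝ) ^ (n * t)) (Y t)) {γ : ℝ} (hγ : 0 < γ) (hγ1 : γ ≤ 1)
    (η : Fin n → ℝ) (hη : ∀ t, η ∉ slab (Y t) γ) :
    0 < ⨅ x : {x : Fin m → ℤ // x ≠ 0},
            (⨆ j : Fin n, dnint ((∑ i : Fin m, θ i j * (x.val i : ℝ)) - η j)) ^ n *
              (⨆ i : Fin m, (|x.val i| : ℝ)) ^ m := by
  have hmr : (1 : ℝ) ≤ m := by exact_mod_cast hm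
  have hnr : (1 : ℝ) ≤ n := by exact_mod_cast hn
  have hbr : (1 : ℝ) < b := by exact_mod_cast hb
  have hb0 : (0 : ℝ) < b := by linarith
  have : Nonempty {x : Fin m → ℤ // x ≠ 0} :=
    ⟨⟨fun _ => 1, fun h => one_ne_zero (congrFun h ⟨0, hm⟩)⟩⟩
  have hc : 0 < (γ / (2 * n)) ^ n * (γ / (2 * m)) ^ m / (b : ℝ) ^ (m * n) := by positivity
  refine lt_of_lt_of_le hc (le_ciInf ?_)
  rintro ⟨x, hx⟩
  simp only
  set ψ := ⨆ j : Fin n, dnint ((∑ i : Fin m, θ i j * (x i : ℝ)) - η j) with hψd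
  set X := ⨆ i : Fin m, |(x i : ℝ)| with hXd
  have hψ : ∀ j, dnint ((∑ i : Fin m, θ i j * (x i : ℝ)) - η j) ≤ ψ := fun j =>
    le_ciSup (f := fun j => dnint ((∑ i : Fin m, θ i j * (x i : ℝ)) - η j))
      (Set.finite_range _).bddAbove j
  have hX : ∀ i, |(x i : ℝ)| ≤ X := fun i =>
    le_ciSup (f := fun i => |(x i : ℝ)|) (Set.finite_range _).bddAbove i
  have hX1 : 1 ≤ X := by
    obtain ⟨i, hi⟩ := Function.ne_iff.1 hx
    refine le_trans ?_ (hX i)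
    have : (1 : ℤ) ≤ |x i| := Int.one_le_abs hi
    exact_mod_cast this
  have hψ0 : 0 ≤ ψ := by
    refine le_trans ?_ (hψ ⟨0, hn⟩)
    exact Real.iInf_nonneg fun _ => abs_nonneg _
  have hex : ∃ t : ℕ, 2 * m * X / γ ≤ (b : ℝ) ^ (n * t) := by
    obtain ⟨t, ht⟩ := pow_unbounded_of_one_lt (2 * m * X / γ) hbr
    refine ⟨t, ht.le.trans (pow_le_pow_right₀ hbr.le ?_)⟩
    exact Nat.le_mul_of_pos_left t hn
  classical
  obtain ⟨t, ht, htmin⟩ : ∃ t : ℕ, 2 * m * X / γ ≤ (b : ℝ) ^ (n * (t + 1)) ∧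
      (b : ℝ) ^ (n * t) ≤ 2 * m * X / γ := by
    have h1 := Nat.find_spec hex
    have h2 := fun t => Nat.find_min (H := hex) (m := t)
    rcases h0 : Nat.find hex with _ | t
    · exfalso
      rw [h0] at h1
      simp only [mul_zero, pow_zero] at h1
      rw [div_le_one hγ] at h1
      nlinarith
    · rw [h0] at h1
      exact ⟨t, h1, le_of_not_ge (h2 t (by omega))⟩
  have hB : (0 : ℝ) < (b : ℝ) ^ (n * (t + 1)) := by positivity
  have hB' : (0 : ℝ) < (b : ℝ) ^ (m * (t + 1)) := by positivity
  have key := transfer_s5 θ η x (Y (t + 1)) (hη (t + 1)) (hYs (t + 1)) hψ hX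
  have k1 : m * (X * (1 / (b : ℝ) ^ (n * (t + 1)))) ≤ γ / 2 := by
    rw [div_le_iff₀ hγ] at ht
    rw [← mul_assoc, mul_one_div, div_le_iff₀ hB]
    linarith
  have k2 : (hgt (Y (t + 1)) : ℝ) ≤ (b : ℝ) ^ (m * (t + 1)) := by exact_mod_cast hY (t + 1)
  have k3 : γ / 2 ≤ n * ((b : ℝ) ^ (m * (t + 1)) * ψ) := by
    have : n * ((hgt (Y (t + 1)) : ℝ) * ψ) ≤ n * ((b : ℝ) ^ (m * (t + 1)) * ψ) := by gcongr
    linarith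
  have k4 : γ / (2 * n) / (b : ℝ) ^ (m * (t + 1)) ≤ ψ := by
    rw [div_le_iff₀ hB', div_le_iff₀ (by positivity)]
    linarith
  have k5 : γ / (2 * m) * (b : ℝ) ^ (n * t) ≤ X := by
    rw [le_div_iff₀ hγ] at htmin
    rw [div_mul_eq_mul_div, div_le_iff₀ (by positivity)]
    linarith
  calc _ = (γ / (2 * n) / (b : ℝ) ^ (m * (t + 1))) ^ n * (γ / (2 * m) * (b : ℝ) ^ (n * t)) ^ m := by
        rw [div_pow _ ((b : ℝ) ^ (m * (t + 1))), mul_pow _ ((b : ℝ) ^ (n * t)), ← pow_mul, ← pow_mul]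
        have : (b : ℝ) ^ (m * (t + 1) * n) = (b : ℝ) ^ (n * t * m) * (b : ℝ) ^ (m * n) := by
          rw [← pow_add]; congr 1; ring
        rw [this]
        field_simp
    _ ≤ ψ ^ n * X ^ m := by gcongr

lemma exists_level {b : ℕ} (hb : 2 ≤ b) {s : ℝ} (hs : 0 < s) (μ : ℝ≥0)
    (hμ : (μ : ℝ) ≤ (b : ℝ) ^ (-s)) (r : ℝ≥0∞) (hr : r ≤ 1) (δ : ℝ≥0∞) (hδ : δ ≠ 0) :
    ∃ f : ℕ, r ≤ ENNReal.ofReal ((1 / (b : ℝ)) ^ f) ∧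
      (μ : ℝ≥0∞) ^ f ≤ (b : ℝ≥0∞) ^ s * r ^ s + δ := by
  have hbr : (1 : ℝ) < b := by exact_mod_cast hb
  have hb0 : (0 : ℝ) < b := by linarith
  by_cases h : ∃ f : ℕ, ¬ r ≤ ENNReal.ofReal ((1 / (b : ℝ)) ^ (f + 1))
  · classical
    set f := Nat.find h with hf
    have h1 : ¬ r ≤ ENNReal.ofReal ((1 / (b : ℝ)) ^ (f + 1)) := Nat.find_spec h
    have h2 : r ≤ ENNReal.ofReal ((1 / (b : ℝ)) ^ f) := by
      rcases h0 : f with _ | g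
      · simpa using hr
      · by_contra hc
        exact Nat.find_min h (m := g) (by omega) hc
    refine ⟨f, h2, le_add_right ?_⟩
    have h3 : ENNReal.ofReal ((1 / (b : ℝ)) ^ (f + 1)) ^ s ≤ r ^ s :=
      ENNReal.rpow_le_rpow (not_le.1 h1).le hs.le
    refine le_trans ?_ (mul_le_mul_right h3 _)
    rw [ENNReal.ofReal_rpow_of_nonneg (by positivity) hs.le, ← ENNReal.ofReal_natCast,
      ENNReal.ofReal_rpow_of_nonneg hb0.le hs.le, ← ENNReal.ofReal_mul (by positivity),
      ← ENNReal.ofReal_coe_nnreal, ← ENNReal.ofReal_pow (by positivity)]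
    refine ENNReal.ofReal_le_ofReal ?_
    calc (μ : ℝ) ^ f ≤ ((b : ℝ) ^ (-s)) ^ f := by gcongr
      _ = _ := by
        rw [one_div, ← Real.rpow_natCast, ← Real.rpow_natCast, ← Real.rpow_neg_one, ← Real.rpow_mul hb0.le,
          ← Real.rpow_mul hb0.le, ← Real.rpow_mul hb0.le, ← Real.rpow_add hb0]
        congr 1; push_cast; ring
  · push Not at h
    have hμ1 : (μ : ℝ≥0∞) < 1 := by
      have : (μ : ℝ) < 1 := hμ.trans_lt (Real.rpow_lt_one_of_one_lt_of_neg hbr (by linarith))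
      exact_mod_cast this
    have ht := ENNReal.tendsto_pow_atTop_nhds_zero_of_lt_one hμ1
    obtain ⟨f, hf⟩ := ((tendsto_order.1 ht).2 δ (pos_iff_ne_zero.2 hδ)).and
      (Filter.eventually_ge_atTop 1) |>.exists
    obtain ⟨g, rfl⟩ : ∃ g, f = g + 1 := ⟨f - 1, by omega⟩
    exact ⟨g + 1, h g, le_add_left hf.1.le⟩

lemma tsum_finset_bound {α : Type*} (S : Set α) (F : Finset α) (K : ℕ) (hF : F.card ≤ K)
    (P : α → Prop) [DecidablePred P] (h : ∀ y ∈ S, P y → y ∈ F) (c : ℝ≥0∞) :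
    ∑' y : S, (if P y then c else 0) ≤ K * c := by
  classical
  calc ∑' y : S, (if P y then c else 0) ≤ ∑' y : S, (if (y : α) ∈ F then c else 0) := by
        refine ENNReal.tsum_le_tsum fun y => ?_
        by_cases hP : P y
        · simp [hP, h y y.2 hP]
        · simp [hP]
    _ ≤ ∑' y : α, (if y ∈ F then c else 0) :=
        ENNReal.tsum_comp_le_tsum_of_injective Subtype.val_injective _
    _ = ∑ y ∈ F, (if y ∈ F then c else 0) := tsum_eq_sum (fun y hy => by simp [hy])
    _ = F.card * c := by
        rw [Finset.sum_congr rfl (fun y hy => if_pos hy)]; simp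
    _ ≤ K * c := by gcongr

lemma exists_base (N : ℕ) (s : ℝ) (hs : s < (N + 1 : ℕ)) : ∃ b : ℕ, 2 ≤ b ∧
    2 * (2 * (N + 3) + 1) < b ∧ (2 * 5 ^ (N + 1) : ℝ) ≤ (b : ℝ) ^ (((N + 1 : ℕ) : ℝ) - s) := by
  have h := (tendsto_rpow_atTop (sub_pos.2 hs)).comp (tendsto_natCast_atTop_atTop (R := ℝ))
  obtain ⟨b, h1, h2, h3⟩ := ((h.eventually_ge_atTop (2 * 5 ^ (N + 1) : ℝ)).and
    ((Filter.eventually_ge_atTop 2).and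
      (Filter.eventually_gt_atTop (2 * (2 * (N + 3) + 1))))).exists
  exact ⟨b, h2, h3, h1⟩

lemma measure_ne_zero {m N : ℕ} (hm : 0 < m) (θ : ℕ → Fin m → Fin (N + 1) → ℝ) (s : ℝ)
    (hs0 : 0 < s) (hs : s < (N + 1 : ℕ)) (E : Set (Fin (N + 1) → ℝ))
    (hE : ∀ η : Fin (N + 1) → ℝ, (∀ k, 0 < ⨅ x : {x : Fin m → ℤ // x ≠ 0},
            (⨆ j : Fin (N + 1), dnint ((∑ i : Fin m, θ k i j * (x.val i : ℝ)) - η j)) ^ (N + 1) *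
              (⨆ i : Fin m, (|x.val i| : ℝ)) ^ m) → η ∈ E) :
    MeasureTheory.Measure.hausdorffMeasure s E ≠ 0 := by
  classical
  intro hzero
  obtain ⟨b, hb, hb1, hb2⟩ := exists_base N s hs
  have hb0 : 0 < b := by omega
  have hbr : (1 : ℝ) < b := by exact_mod_cast hb
  have hbr0 : (0 : ℝ) < b := by linarith
  have hbnn : (b : ℝ≥0) ≠ 0 := by positivity
  -- contraction factors
  set μ1 : ℝ≥0 := (2 * (2 * (N + 3) + 1) : ℕ) / (b : ℝ≥0) with hμ1
  set μ2 : ℝ≥0 := (2 * 5 ^ (N + 1) : ℕ) / (b : ℝ≥0) ^ (N + 1) with hμ2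
  have hμ1lt : (μ1 : ℝ≥0∞) < 1 := by
    have : μ1 < 1 := by
      rw [hμ1, div_lt_one (by positivity)]
      exact_mod_cast hb1
    exact_mod_cast this
  have hμ2le : (μ2 : ℝ) ≤ (b : ℝ) ^ (-s) := by
    rw [hμ2]
    push_cast
    rw [div_le_iff₀ (by positivity), ← Real.rpow_natCast (b : ℝ) (N + 1), ← Real.rpow_add hbr0]
    refine hb2.trans (le_of_eq ?_)
    congr 1; push_cast; ring
  -- dual sequences
  choose Y K hYne hYh hYs hYK using fun k => exists_dual_seq (Nat.succ_pos N) (θ k) b hb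
  obtain ⟨e1, he1, he1s⟩ := ENNReal.exists_pos_sum_of_countable' (ε := 8⁻¹) (by simp) ℕ
  obtain ⟨e2, he2, he2s⟩ := ENNReal.exists_pos_sum_of_countable' (ε := 16⁻¹) (by simp) ℕ
  have hsk : ∀ k, ∃ t : ℕ, (K k : ℝ≥0∞) * (μ1 : ℝ≥0∞) ^ t ≤ e1 k := by
    intro k
    have ht := ENNReal.Tendsto.const_mul (a := (K k : ℝ≥0∞))
      (ENNReal.tendsto_pow_atTop_nhds_zero_of_lt_one hμ1lt) (Or.inr (by simp))
    rw [mul_zero] at ht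
    obtain ⟨t, ht⟩ := ((tendsto_order.1 ht).2 (e1 k) (he1 k)).exists
    exact ⟨t, ht.le⟩
  choose S hS using hsk
  let γ : ℕ → ℝ := fun k => 1 / (4 * (N + 1) * (b : ℝ) ^ (S k + 1))
  have hγ0 : ∀ k, 0 < γ k := fun k => by positivity
  have hγ8 : ∀ k, γ k ≤ 1 / 8 := by
    intro k
    refine one_div_le_one_div_of_le (by norm_num) ?_
    have h1 : (b : ℝ) ^ 1 ≤ (b : ℝ) ^ (S k + 1) := pow_le_pow_right₀ hbr.le (by omega)
    have h2 : (2 : ℝ) ≤ b := by exact_mod_cast hb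
    have h3 : (0 : ℝ) ≤ N := by positivity
    rw [pow_one] at h1
    nlinarith
  -- cover
  rw [MeasureTheory.Measure.hausdorffMeasure_apply] at hzero
  have hz1 := (iSup₂_eq_bot.1 hzero) 1 (by simp)
  set δ : ℝ≥0∞ := 16⁻¹ * ((b : ℝ≥0∞) ^ s)⁻¹ with hδ
  have hbs0 : (b : ℝ≥0∞) ^ s ≠ 0 := by
    rw [Ne, ENNReal.rpow_eq_zero_iff]
    rintro (⟨h, _⟩ | ⟨h, _⟩)
    · exact hb0.ne' (by exact_mod_cast h)
    · simp at h
  have hbst : (b : ℝ≥0∞) ^ s ≠ ∞ := ENNReal.rpow_ne_top_of_nonneg hs0.le (by simp)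
  have hδ0 : 0 < δ := by
    rw [pos_iff_ne_zero, hδ]
    refine mul_ne_zero (by simp) ?_
    simpa using hbst
  have hlt := lt_of_eq_of_lt hz1 hδ0
  simp only [iInf_lt_iff] at hlt
  obtain ⟨T, hTE, hTd, hTs⟩ := hlt
  choose f2 hf2 hf2' using fun i => exists_level hb hs0 μ2 hμ2le (Metric.ediam (T i)) (hTd i)
    (e2 i) (he2 i).ne'
  -- obstacles
  let p1 : (Fin (N + 1) → ℤ) → ℕ := fun y => Nat.clog b (4 * (N + 1) * hgt y)
  let ι := (Σ k : ℕ, Set.range (Y k)) ⊕ ℕ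
  let A : ι → Set (Fin (N + 1) → ℝ) := Sum.elim (fun z => slab z.2.1 (γ z.1)) T
  let p : ι → ℕ := Sum.elim (fun z => p1 z.2.1) (fun _ => 0)
  let f : ι → ℕ := Sum.elim (fun z => p1 z.2.1 + S z.1) f2
  let μ : ι → ℝ≥0 := Sum.elim (fun _ => μ1) (fun _ => μ2)
  have hp1 : ∀ y : Fin (N + 1) → ℤ, 4 * (N + 1) * hgt y ≤ b ^ p1 y := fun y =>
    Nat.le_pow_clog hb _
  have hp2 : ∀ y : Fin (N + 1) → ℤ, y ≠ 0 → b ^ p1 y < b * (4 * (N + 1) * hgt y) := by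
    intro y hy
    have h1 : 1 < 4 * (N + 1) * hgt y := by
      have := hgt_pos hy
      nlinarith
    have h2 := Nat.pow_pred_clog_lt_self hb h1
    have h3 : 0 < p1 y := Nat.clog_pos hb h1
    calc b ^ p1 y = b * b ^ (p1 y).pred := by rw [← pow_succ']; congr 1; exact (Nat.succ_pred_eq_of_pos h3).symm
      _ < _ := Nat.mul_lt_mul_of_pos_left h2 hb0
  have hex : ∃ η : Fin (N + 1) → ℝ, ∀ i, η ∉ A i := by
    refine avoid hb0 A p f μ ?_ ?_ ?_
    · rintro (z | i)
      · simp [p, f]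
      · simp [p]
    · rintro (⟨k, y, t, rfl⟩ | i) q v hq1 hq2
      · simp only [p, f, Sum.elim_inl] at hq1 hq2
        simp only [A, μ, Sum.elim_inl]
        have h1 := count_slab hb0 (y := Y k t) (hγ8 k) (q := q)
          ((hp1 _).trans (Nat.pow_le_pow_right hb0 hq1)) (by
            have h2 : (b : ℝ) ^ (q + 1) ≤ (b : ℝ) ^ (p1 (Y k t) + S k) :=
              pow_le_pow_right₀ hbr.le hq2
            have h3 : (b : ℝ) ^ p1 (Y k t) ≤ b * (4 * (N + 1) * hgt (Y k t)) := by
              exact_mod_cast (hp2 _ (hYne k t)).le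
            simp only [γ]
            rw [div_mul_eq_mul_div, div_le_iff₀ (by positivity), one_mul]
            calc _ ≤ _ := h2
              _ = (b : ℝ) ^ p1 (Y k t) * (b : ℝ) ^ S k := pow_add _ _ _
              _ ≤ b * (4 * (N + 1) * hgt (Y k t)) * (b : ℝ) ^ S k := by gcongr
              _ = _ := by ring) (hYne k t) v
        calc _ ≤ 2 * (((2 * (N + 3) + 1) * b ^ N : ℕ) : ℝ≥0) := by
              gcongr
              exact (Finset.card_le_card (fun d hd => Finset.mem_filter.2 ⟨Finset.mem_univ d, (Finset.mem_filter.1 hd).2⟩)).trans h1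
          _ = μ1 * (b : ℝ≥0) ^ (N + 1) := by
              rw [hμ1, pow_succ]
              push_cast
              field_simp
      · simp only [p, f, Sum.elim_inr] at hq1 hq2
        simp only [A, μ, Sum.elim_inr]
        have h1 := count_small hb0 (T i) v (q := q) (by
          intro x hx y hy j
          have h2 : edist x y ≤ ENNReal.ofReal ((1 / (b : ℝ)) ^ f2 i) :=
            (Metric.edist_le_ediam_of_mem hx hy).trans (hf2 i)
          rw [edist_dist, ENNReal.ofReal_le_ofReal_iff (by positivity)] at h2
          have h3 : |x j - y j| ≤ (1 / (b : ℝ)) ^ f2 i := (dist_le_pi_dist x y j).trans h2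
          calc (b : ℝ) ^ (q + 1) * |x j - y j| ≤ (b : ℝ) ^ (f2 i) * (1 / (b : ℝ)) ^ f2 i := by
                gcongr
                · exact hbr.le
                · exact hq2
            _ = 1 := by rw [← mul_pow, mul_one_div_cancel hbr0.ne', one_pow])
        calc _ ≤ 2 * ((5 ^ (N + 1) : ℕ) : ℝ≥0) := by
              gcongr
              exact (Finset.card_le_card (fun d hd => Finset.mem_filter.2 ⟨Finset.mem_univ d, (Finset.mem_filter.1 hd).2⟩)).trans h1
          _ = μ2 * (b : ℝ≥0) ^ (N + 1) := by
              rw [hμ2]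
              push_cast
              field_simp
    · intro q
      rw [Summable.tsum_sum ENNReal.summable ENNReal.summable]
      have h84 : (8⁻¹ : ℝ≥0∞) + 8⁻¹ = 4⁻¹ := by
        rw [← two_mul, show (8 : ℝ≥0∞) = 2 * 4 by norm_num, ENNReal.mul_inv (by simp) (by simp),
          ← mul_assoc, ENNReal.mul_inv_cancel (by simp) (by simp), one_mul]
      have h168 : (16⁻¹ : ℝ≥0∞) + 16⁻¹ = 8⁻¹ := by
        rw [← two_mul, show (16 : ℝ≥0∞) = 2 * 8 by norm_num, ENNReal.mul_inv (by simp) (by simp),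
          ← mul_assoc, ENNReal.mul_inv_cancel (by simp) (by simp), one_mul]
      rw [← h84]
      refine add_le_add ?_ ?_
      · change ∑' z : (Σ k : ℕ, Set.range (Y k)),
          (if p1 z.2.1 = q then (μ1 : ℝ≥0∞) ^ (p1 z.2.1 + S z.1 - q) else 0) ≤ _
        rw [ENNReal.tsum_sigma']
        refine le_trans (ENNReal.tsum_le_tsum fun k => ?_) he1s.le
        refine le_trans ?_ (hS k)
        obtain ⟨F, hF, hFK⟩ := hYK k {y | y ∈ Set.range (Y k) ∧ p1 y = q} (fun y hy => hy.1) (by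
          rintro y ⟨⟨t, rfl⟩, hy⟩ y' ⟨_, hy'⟩
          have h1 := hp1 y'
          have h2 := hp2 (Y k t) (hYne k t)
          rw [hy'] at h1
          rw [hy] at h2
          have h3 := lt_of_le_of_lt h1 h2
          have h4 : 4 * (N + 1) * hgt y' < 4 * (N + 1) * (b * hgt (Y k t)) := by linarith
          exact Nat.lt_of_mul_lt_mul_left h4)
        refine le_trans (le_of_eq ?_) (tsum_finset_bound (Set.range (Y k)) F (K k) hFK
          (fun y => p1 y = q) (fun y hy h => hF ⟨hy, h⟩) ((μ1 : ℝ≥0∞) ^ S k))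
        refine tsum_congr fun y => ?_
        by_cases h : p1 y.1 = q
        · rw [if_pos h, if_pos h]
          change (μ1 : ℝ≥0∞) ^ (p1 y.1 + S k - q) = _
          rw [h, Nat.add_sub_cancel_left]
        · rw [if_neg h, if_neg h]
      · change ∑' i : ℕ, (if 0 = q then (μ2 : ℝ≥0∞) ^ (f2 i - q) else 0) ≤ _
        calc _ ≤ ∑' i, ((b : ℝ≥0∞) ^ s * (⨆ _ : (T i).Nonempty, Metric.ediam (T i) ^ s) + e2 i) := by
              refine ENNReal.tsum_le_tsum fun i => ?_
              by_cases h : 0 = q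
              · rw [if_pos h, ← h, Nat.sub_zero]
                refine (hf2' i).trans ?_
                gcongr
                rcases (T i).eq_empty_or_nonempty with h | h
                · simp [h, hs0]
                · simp [h]
              · rw [if_neg h]
                exact zero_le
          _ = (b : ℝ≥0∞) ^ s * (∑' i, ⨆ _ : (T i).Nonempty, Metric.ediam (T i) ^ s) + ∑' i, e2 i := by
              rw [ENNReal.tsum_add, ENNReal.tsum_mul_left]
          _ ≤ (b : ℝ≥0∞) ^ s * δ + 16⁻¹ := by gcongr
          _ = 8⁻¹ := by
              rw [hδ, mul_left_comm, ENNReal.mul_inv_cancel hbs0 hbst, mul_one, h168]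
  obtain ⟨η, hη⟩ := hex
  · have hηE : η ∈ E := by
      refine hE η fun k => ?_
      exact bad_of_avoid hm (Nat.succ_pos N) hb (θ k) (Y k) (hYh k) (hYs k) (hγ0 k)
        ((hγ8 k).trans (by norm_num)) η (fun t => hη (Sum.inl ⟨k, Y k t, t, rfl⟩))
    obtain ⟨i, hi⟩ := Set.mem_iUnion.1 (hTE hηE)
    exact hη (Sum.inr i) hi

theorem bad_sets_countable_intersection (m n : ℕ) (hm : 0 < m) (hn : 0 < n)
    (θ : ℕ → Fin m → Fin n → ℝ) :
    dimH (⋂ k : ℕ, {η : Fin n → ℝ |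
        0 < ⨅ x : {x : Fin m → ℤ // x ≠ 0},
            (⨆ j : Fin n, dnint ((∑ i : Fin m, θ k i j * (x.val i : ℝ)) - η j)) ^ n *
              (⨆ i : Fin m, (|x.val i| : ℝ)) ^ m}) = (n : ℕ) ∧
    (⋂ k : ℕ, {η : Fin n → ℝ |
        0 < ⨅ x : {x : Fin m → ℤ // x ≠ 0},
            (⨆ j : Fin n, dnint ((∑ i : Fin m, θ k i j * (x.val i : ℝ)) - η j)) ^ n *
              (⨆ i : Fin m, (|x.val i| : ℝ)) ^ m}).Nonempty := by
  obtain ⟨N, rfl⟩ : ∃ N, n = N + 1 := ⟨n - 1, by omega⟩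
  set E := (⋂ k : ℕ, {η : Fin (N + 1) → ℝ |
        0 < ⨅ x : {x : Fin m → ℤ // x ≠ 0},
            (⨆ j : Fin (N + 1), dnint ((∑ i : Fin m, θ k i j * (x.val i : ℝ)) - η j)) ^ (N + 1) *
              (⨆ i : Fin m, (|x.val i| : ℝ)) ^ m}) with hEdef
  have hdim : dimH E = ((N + 1 : ℕ) : ℝ≥0∞) := by
    refine le_antisymm ?_ ?_
    · rw [← Real.dimH_univ_pi_fin]
      exact dimH_mono (Set.subset_univ _)
    · refine le_of_forall_lt_imp_le_of_dense fun c hc => ?_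
      lift c to ℝ≥0 using hc.ne_top
      rcases eq_or_ne c 0 with rfl | hc0
      · simp
      · refine le_dimH_of_hausdorffMeasure_ne_zero ?_
        refine measure_ne_zero hm θ c (by positivity) ?_ E fun η h => ?_
        · have : c < ((N + 1 : ℕ) : ℝ≥0) := by exact_mod_cast hc
          exact_mod_cast this
        · exact Set.mem_iInter.2 h
  refine ⟨hdim, ?_⟩
  rw [Set.nonempty_iff_ne_empty]
  intro h
  rw [h, dimH_empty] at hdim
  exact absurd hdim.symm (by simp)
end
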